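/- arXiv:1709.00446 — 5 statements merged into one kernel-verified Lean document; each statement's English description precedes it below -/
import Mathlib

section
/- Let f be an nc self-map of 𝔅_d with f₁(0) = 0. If there exist n ≥ 1 and a generic point X ∈ 𝔅_d(n) with f_n(X) = X whose coordinates X_1,…,X_d are linearly independent over ℂ, then f is the identity map: f_m(Z) = Z for every m ≥ 1 and every Z ∈ 𝔅_d(m). -/
open Matrix
open scoped ComplexOrder

attribute [local instance] Matrix.normedAddCommGroup Matrix.normedSpace

/-- The space of `d`-tuples of `n × n` complex matrices. -/
abbrev MatTuple (d n : ℕ) := Fin d → Matrix (Fin n) (Fin n) ℂ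

/-- The free matrix ball at level `n`: strict row contractions. -/
def freeBall (d n : ℕ) : Set (MatTuple d n) :=
  {X | (1 - ∑ j, X j * (X j)ᴴ).PosDef}

/-- The direct sum of two tuples of matrices. -/
def dSum {d n m : ℕ} (X : MatTuple d n) (Y : MatTuple d m) : MatTuple d (n + m) :=
  fun j => Matrix.reindex finSumFinEquiv finSumFinEquiv (Matrix.fromBlocks (X j) 0 0 (Y j))

/-- An nc self-map of the free ball `𝔅_d`. -/
structure NCSelfMap (d : ℕ) where
  app : ∀ n, MatTuple d n → MatTuple d n
  mapsTo : ∀ n, Set.MapsTo (app n) (freeBall d n) (freeBall d n)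
  map_dSum : ∀ {n m : ℕ} (X : MatTuple d n) (Y : MatTuple d m),
    X ∈ freeBall d n → Y ∈ freeBall d m →
    app (n + m) (dSum X Y) = dSum (app n X) (app m Y)
  map_sim : ∀ {n : ℕ} (X : MatTuple d n) (S : Matrix (Fin n) (Fin n) ℂ),
    X ∈ freeBall d n → IsUnit S →
    (fun j => S⁻¹ * X j * S) ∈ freeBall d n →
    app n (fun j => S⁻¹ * X j * S) = fun j => S⁻¹ * app n X j * S
  holo : ∀ n, DifferentiableOn ℂ (app n) (freeBall d n)

/-- A tuple is generic if its coordinates generate the full matrix algebra. -/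
def IsGeneric {d n : ℕ} (X : MatTuple d n) : Prop :=
  Algebra.adjoin ℂ (Set.range X) = ⊤

/-- The homogeneous degree-one linear relations satisfied by the coordinates of `X`. -/
def linRel {d n : ℕ} (X : MatTuple d n) : Set (Fin d → ℂ) :=
  {α | ∑ j, α j • X j = 0}

/-- The scalar point of level `n` associated to a vector in `ℂ^d`. -/
def scalarPt (d n : ℕ) (v : Fin d → ℂ) : MatTuple d n :=
  fun j => v j • (1 : Matrix (Fin n) (Fin n) ℂ)

open scoped MatrixOrder Matrix.Norms.L2Operator in
theorem exists_eq_conjTranspose_mul_self_of_posSemidef {n : ℕ} {P : Matrix (Fin n) (Fin n) ℂ}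
    (hP : P.PosSemidef) : ∃ B : Matrix (Fin n) (Fin n) ℂ, P = Bᴴ * B :=
  CStarAlgebra.nonneg_iff_eq_star_mul_self.mp hP.nonneg

/-- Positive definiteness is an open condition along continuous families of Hermitian matrices. -/
theorem eventually_posDef {T : Type*} [TopologicalSpace T] {n : ℕ}
    {h : T → Matrix (Fin n) (Fin n) ℂ} (hc : Continuous h) (hH : ∀ t, (h t).IsHermitian)
    {t₀ : T} (h₀ : (h t₀).PosDef) : ∀ᶠ t in nhds t₀, (h t).PosDef := by
  have hK : IsCompact (Metric.sphere (0 : Fin n → ℂ) 1) := isCompact_sphere _ _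
  have key : ∀ᶠ t in nhds t₀, ∀ x ∈ Metric.sphere (0 : Fin n → ℂ) 1,
      0 < (star x ⬝ᵥ (h t *ᵥ x)).re := by
    refine hK.eventually_forall_of_forall_eventually fun x hx => ?_
    have hcont : Continuous fun p : T × (Fin n → ℂ) => (star p.2 ⬝ᵥ (h p.1 *ᵥ p.2)).re := by
      fun_prop
    refine hcont.continuousAt.eventually (lt_mem_nhds ?_)
    have hx0 : x ≠ 0 := by rintro rfl; simp at hx
    exact h₀.re_dotProduct_pos hx0
  filter_upwards [key] with t ht
  refine PosDef.of_dotProduct_mulVec_pos (hH t) fun x hx => ?_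
  have him : (star x ⬝ᵥ (h t *ᵥ x)).im = 0 := (hH t).im_star_dotProduct_mulVec_self x
  have hpos := ht (((‖x‖⁻¹ : ℝ) : ℂ) • x) (by simp [norm_smul, hx])
  rw [Complex.lt_def]
  refine ⟨?_, by simpa using him.symm⟩
  rw [star_smul, mulVec_smul, smul_dotProduct, dotProduct_smul] at hpos
  have hxn : 0 < ‖x‖⁻¹ := by positivity
  simp only [RCLike.star_def, Complex.conj_ofReal, smul_eq_mul, Complex.re_ofReal_mul] at hpos
  simpa using pos_of_mul_pos_right (pos_of_mul_pos_right hpos hxn.le) hxn.le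

theorem isClosed_posSemidef (n : ℕ) :
    IsClosed {M : Matrix (Fin n) (Fin n) ℂ | M.PosSemidef} := by
  simp only [posSemidef_iff_dotProduct_mulVec, Set.ofPred_and, Set.ofPred_forall]
  refine IsClosed.inter (isClosed_eq (by fun_prop) (by fun_prop)) (isClosed_iInter fun x => ?_)
  exact isClosed_le (by fun_prop) (by fun_prop)

theorem isHermitian_one_sub_sum {d n : ℕ} (X : MatTuple d n) :
    (1 - ∑ j, X j * (X j)ᴴ).IsHermitian := by
  simp [IsHermitian, conjTranspose_sum]

theorem isOpen_freeBall (d n : ℕ) : IsOpen (freeBall d n) :=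
  isOpen_iff_mem_nhds.2 fun X hX =>
    eventually_posDef (h := fun X : MatTuple d n => 1 - ∑ j, X j * (X j)ᴴ) (by fun_prop)
      isHermitian_one_sub_sum hX

theorem zero_mem_freeBall (d n : ℕ) : (0 : MatTuple d n) ∈ freeBall d n := by
  simp [freeBall, PosDef.one]

theorem freeBall_mem_nhds_zero (d n : ℕ) : freeBall d n ∈ nhds 0 :=
  (isOpen_freeBall d n).mem_nhds (zero_mem_freeBall d n)

theorem smul_mem_freeBall {d n : ℕ} {U : MatTuple d n} (hU : ∑ j, U j * (U j)ᴴ = 1)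
    {z : ℂ} (hz : ‖z‖ < 1) : z • U ∈ freeBall d n := by
  have h1 : ∑ j, (z • U) j * ((z • U) j)ᴴ = ((‖z‖ ^ 2 : ℝ) : ℂ) • 1 := by
    simp only [Pi.smul_apply, conjTranspose_smul, smul_mul_smul_comm, ← Finset.smul_sum, hU]
    simp [Complex.mul_conj, Complex.normSq_eq_norm_sq]
  have h2 : (0 : ℂ) < ((1 - ‖z‖ ^ 2 : ℝ) : ℂ) := by
    have : ‖z‖ ^ 2 < 1 := by nlinarith [norm_nonneg z]
    exact_mod_cast sub_pos.2 this
  have h3 := (PosDef.one (n := Fin n) (R := ℂ)).smul h2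
  rw [freeBall, Set.mem_ofPred_eq, h1]
  convert h3 using 1
  push_cast
  module

/-- The matrix tuple as a vector in the Hilbert space of its entries. -/
noncomputable def entries (d n : ℕ) :
    MatTuple d n →L[ℂ] EuclideanSpace ℂ (Fin d × Fin n × Fin n) :=
  LinearMap.toContinuousLinearMap
    { toFun := fun X => WithLp.toLp 2 fun p => X p.1 p.2.1 p.2.2
      map_add' := fun _ _ => rfl
      map_smul' := fun _ _ => rfl }

theorem entries_apply {d n : ℕ} (X : MatTuple d n) (p : Fin d × Fin n × Fin n) :
    entries d n X p = X p.1 p.2.1 p.2.2 := rfl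

theorem entries_injective (d n : ℕ) : Function.Injective (entries d n) := by
  intro X Y h
  ext j a b
  simpa [entries_apply] using congrArg (fun v => v (j, a, b)) h

theorem norm_entries_sq {d n : ℕ} (X : MatTuple d n) :
    ‖entries d n X‖ ^ 2 = (trace (∑ j, X j * (X j)ᴴ)).re := by
  rw [EuclideanSpace.norm_sq_eq, Fintype.sum_prod_type]
  simp only [trace_sum, Complex.re_sum]
  refine Finset.sum_congr rfl fun j _ => ?_
  rw [Fintype.sum_prod_type]
  simp [trace, mul_apply, entries_apply, Complex.mul_conj, Complex.normSq_eq_norm_sq,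
    -Complex.ofReal_pow]

theorem norm_entries_le {d n : ℕ} {X : MatTuple d n} (hX : X ∈ freeBall d n) :
    ‖entries d n X‖ ≤ √n := by
  refine Real.le_sqrt_of_sq_le ?_
  rw [norm_entries_sq]
  have := (Complex.le_def.1 hX.posSemidef.trace_nonneg).1
  simpa [trace_sub] using this

theorem norm_entries_of_sum_eq_one {d n : ℕ} {U : MatTuple d n}
    (hU : ∑ j, U j * (U j)ᴴ = 1) : ‖entries d n U‖ = √n := by
  rw [← Real.sqrt_sq (norm_nonneg (entries d n U)), norm_entries_sq, hU]
  simp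

/-- The completely positive map `P ↦ ∑ j, X j * P * (X j)ᴴ` associated to a matrix tuple. -/
noncomputable def cpMap {d n : ℕ} (X : MatTuple d n) :
    Module.End ℂ (Matrix (Fin n) (Fin n) ℂ) :=
  ∑ j, (LinearMap.mulRight ℂ (X j)ᴴ).comp (LinearMap.mulLeft ℂ (X j))

theorem cpMap_apply {d n : ℕ} (X : MatTuple d n) (P : Matrix (Fin n) (Fin n) ℂ) :
    cpMap X P = ∑ j, X j * P * (X j)ᴴ := by
  simp [cpMap]

theorem continuous_cpMap {d n : ℕ} (X : MatTuple d n) : Continuous (cpMap X) := by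
  simp only [funext (cpMap_apply X)]
  fun_prop

theorem posSemidef_cpMap {d n : ℕ} (X : MatTuple d n) {P : Matrix (Fin n) (Fin n) ℂ}
    (hP : P.PosSemidef) : (cpMap X P).PosSemidef := by
  rw [cpMap_apply]
  exact posSemidef_sum _ fun j _ => hP.mul_mul_conjTranspose_same _

theorem star_dotProduct_cpMap {d n : ℕ} (X : MatTuple d n) (P : Matrix (Fin n) (Fin n) ℂ)
    (v : Fin n → ℂ) : star v ⬝ᵥ (cpMap X P *ᵥ v) =
      ∑ j, star ((X j)ᴴ *ᵥ v) ⬝ᵥ (P *ᵥ ((X j)ᴴ *ᵥ v)) := by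
  rw [cpMap_apply, sum_mulVec, dotProduct_sum]
  refine Finset.sum_congr rfl fun j _ => ?_
  rw [star_mulVec, conjTranspose_conjTranspose, ← dotProduct_mulVec, mulVec_mulVec, mulVec_mulVec,
    mul_assoc]

theorem posSemidef_one_add_cpMap_pow {d n : ℕ} (X : MatTuple d n) {P : Matrix (Fin n) (Fin n) ℂ}
    (hP : P.PosSemidef) (N : ℕ) : (((1 + cpMap X) ^ N) P).PosSemidef := by
  induction N with
  | zero => simpa using hP
  | succ N ih =>
    rw [pow_succ', Module.End.mul_apply, LinearMap.add_apply, Module.End.one_apply]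
    exact ih.add (posSemidef_cpMap X ih)

theorem mulVec_one_add_cpMap_eq_zero {d n : ℕ} (X : MatTuple d n) {P : Matrix (Fin n) (Fin n) ℂ}
    (hP : P.PosSemidef) {v : Fin n → ℂ} (hv : ((1 + cpMap X) P) *ᵥ v = 0) :
    P *ᵥ v = 0 ∧ ∀ j, P *ᵥ ((X j)ᴴ *ᵥ v) = 0 := by
  have h1 : star v ⬝ᵥ (P *ᵥ v) + star v ⬝ᵥ (cpMap X P *ᵥ v) = 0 := by
    rw [← dotProduct_add, ← add_mulVec]
    simpa using congrArg (star v ⬝ᵥ ·) hv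
  rw [add_eq_zero_iff_of_nonneg (hP.dotProduct_mulVec_nonneg v)
    ((posSemidef_cpMap X hP).dotProduct_mulVec_nonneg v), star_dotProduct_cpMap,
    Finset.sum_eq_zero_iff_of_nonneg fun j _ => hP.dotProduct_mulVec_nonneg _] at h1
  exact ⟨(hP.dotProduct_mulVec_zero_iff v).1 h1.1,
    fun j => (hP.dotProduct_mulVec_zero_iff _).1 (h1.2 j (Finset.mem_univ j))⟩

/-- A nonzero vector generates everything under the adjoints of a generic tuple. -/
theorem IsGeneric.eq_top_of_invariant {d n : ℕ} {X : MatTuple d n} (hX : IsGeneric X)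
    {K : Submodule ℂ (Fin n → ℂ)} (hK : ∀ j, ∀ v ∈ K, (X j)ᴴ *ᵥ v ∈ K)
    {v : Fin n → ℂ} (hv : v ∈ K) (hv0 : v ≠ 0) : K = ⊤ := by
  have hA : ∀ A : Matrix (Fin n) (Fin n) ℂ, ∀ w ∈ K, Aᴴ *ᵥ w ∈ K := by
    intro A
    have hmem : A ∈ Algebra.adjoin ℂ (Set.range X) := by
      rw [show Algebra.adjoin ℂ (Set.range X) = ⊤ from hX]; trivial
    induction hmem using Algebra.adjoin_induction with
    | mem x hx =>
      obtain ⟨j, rfl⟩ := hx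
      exact hK j
    | algebraMap r =>
      intro w hw
      rw [Algebra.algebraMap_eq_smul_one, conjTranspose_smul, conjTranspose_one, smul_mulVec,
        one_mulVec]
      exact K.smul_mem _ hw
    | add x y _ _ hx hy =>
      intro w hw
      rw [conjTranspose_add, add_mulVec]
      exact K.add_mem (hx w hw) (hy w hw)
    | mul x y _ _ hx hy =>
      intro w hw
      rw [conjTranspose_mul, ← mulVec_mulVec]
      exact hy _ (hx w hw)
  rw [eq_top_iff]
  intro w _
  have h := hA (vecMulVec w (star v))ᴴ v hv
  rw [conjTranspose_conjTranspose, vecMulVec_mulVec] at h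
  have hne : star v ⬝ᵥ v ≠ 0 := by simpa using hv0
  have h2 := K.smul_mem (star v ⬝ᵥ v)⁻¹ h
  simpa [smul_smul, hne] using h2

/-- Irreducibility: some power of `1 + cpMap X` makes a nonzero positive semidefinite matrix
positive definite. -/
theorem IsGeneric.exists_posDef_pow {d n : ℕ} {X : MatTuple d n} (hX : IsGeneric X)
    {Q : Matrix (Fin n) (Fin n) ℂ} (hQ : Q.PosSemidef) (hQ0 : Q ≠ 0) :
    ∃ N : ℕ, (((1 + cpMap X) ^ N) Q).PosDef := by
  have hpsd := posSemidef_one_add_cpMap_pow X hQ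
  have hstep : ∀ (N : ℕ) (v : Fin n → ℂ), ((1 + cpMap X) ^ (N + 1)) Q *ᵥ v = 0 →
      ((1 + cpMap X) ^ N) Q *ᵥ v = 0 ∧ ∀ j, ((1 + cpMap X) ^ N) Q *ᵥ ((X j)ᴴ *ᵥ v) = 0 := by
    intro N v hv
    rw [pow_succ', Module.End.mul_apply] at hv
    exact mulVec_one_add_cpMap_eq_zero X (hpsd N) hv
  let K : ℕ → (Submodule ℂ (Fin n → ℂ))ᵒᵈ := fun N =>
    OrderDual.toDual (LinearMap.ker (mulVecLin (((1 + cpMap X) ^ N) Q)))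
  have hmono : Monotone K := monotone_nat_of_le_succ fun N v hv => (hstep N v hv).1
  obtain ⟨N, hN⟩ := IsArtinian.monotone_stabilizes ⟨K, hmono⟩
  refine ⟨N, PosDef.of_dotProduct_mulVec_pos (hpsd N).1 fun v hv =>
    lt_of_le_of_ne ((hpsd N).dotProduct_mulVec_nonneg v) fun h0 => ?_⟩
  have hvK : ((1 + cpMap X) ^ N) Q *ᵥ v = 0 := ((hpsd N).dotProduct_mulVec_zero_iff v).1 h0.symm
  have hinv : ∀ j, ∀ w ∈ LinearMap.ker (mulVecLin (((1 + cpMap X) ^ N) Q)),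
      (X j)ᴴ *ᵥ w ∈ LinearMap.ker (mulVecLin (((1 + cpMap X) ^ N) Q)) := by
    intro j w hw
    have hw' : w ∈ OrderDual.ofDual (K (N + 1)) := by
      have := hN (N + 1) (Nat.le_succ N)
      simp only [OrderHom.coe_mk] at this
      rw [← this]
      exact hw
    exact (hstep N w hw').2 j
  have htop := hX.eq_top_of_invariant hinv (v := v) hvK hv
  apply hQ0
  ext a b
  have hb : Pi.single b 1 ∈ OrderDual.ofDual (K 0) := by
    refine hmono (Nat.zero_le N) ?_
    change Pi.single b 1 ∈ LinearMap.ker (mulVecLin (((1 + cpMap X) ^ N) Q))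
    rw [htop]; trivial
  have hcol : Q *ᵥ Pi.single b 1 = 0 := hb
  simpa using congrFun hcol a

/-- On the free ball the associated positive map has spectral radius less than one. -/
theorem lt_one_of_posSemidef_cpMap_sub {d n : ℕ} {X : MatTuple d n} (hX : X ∈ freeBall d n)
    {P : Matrix (Fin n) (Fin n) ℂ} (hP : P.PosSemidef) (hP0 : P ≠ 0) {t : ℝ} (ht : 0 ≤ t)
    (h : (cpMap X P - (t : ℂ) • P).PosSemidef) : t < 1 := by
  have htr : 0 < P.trace.re := by
    have h1 := hP.trace_nonneg
    have h2 : P.trace ≠ 0 := fun h => hP0 (hP.trace_eq_zero_iff.1 h)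
    exact (Complex.lt_def.1 (lt_of_le_of_ne h1 h2.symm)).1
  have hher : ∀ s : ℝ, (1 - (s : ℂ) • P).IsHermitian := fun s => by
    simp [IsHermitian, hP.1.eq]
  let I : Set ℝ := {s | 0 ≤ s ∧ (1 - (s : ℂ) • P).PosSemidef}
  have hIclosed : IsClosed I :=
    isClosed_Ici.inter ((isClosed_posSemidef n).preimage
      (f := fun s : ℝ => 1 - (s : ℂ) • P) (by fun_prop))
  have hIsub : I ⊆ Set.Icc 0 (n / P.trace.re) := by
    rintro s ⟨hs, hs'⟩
    refine ⟨hs, ?_⟩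
    have := (Complex.le_def.1 hs'.trace_nonneg).1
    rw [le_div_iff₀ htr]
    simpa [trace_sub, trace_smul] using this
  have hI0 : (0 : ℝ) ∈ I := ⟨le_rfl, by simpa using PosSemidef.one⟩
  obtain ⟨s, hs, hmax⟩ := (isCompact_Icc.of_isClosed_subset hIclosed hIsub).exists_isMaxOn
    ⟨0, hI0⟩ continuousOn_id
  have hnot : ¬ (1 - (s : ℂ) • P).PosDef := by
    intro hpd
    have hev := eventually_posDef (h := fun s : ℝ => 1 - (s : ℂ) • P) (by fun_prop) hher hpd
    obtain ⟨u, hu, hu'⟩ := ((hev.filter_mono nhdsWithin_le_nhds).and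
      (self_mem_nhdsWithin : Set.Ioi s ∈ nhdsWithin s (Set.Ioi s))).exists
    have : u ≤ s := hmax (show u ∈ I from ⟨hs.1.trans (le_of_lt hu'), hu.posSemidef⟩)
    exact absurd hu' (not_lt.2 this)
  have hex : ∃ v : Fin n → ℂ, v ≠ 0 ∧ (1 - (s : ℂ) • P) *ᵥ v = 0 := by
    by_contra! hcon
    refine hnot (PosDef.of_dotProduct_mulVec_pos hs.2.1 fun v hv =>
      lt_of_le_of_ne (hs.2.dotProduct_mulVec_nonneg v) fun h0 => hcon v hv ?_)
    exact (hs.2.dotProduct_mulVec_zero_iff v).1 h0.symm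
  obtain ⟨v, hv0, hv⟩ := hex
  have e1 : star v ⬝ᵥ ((s : ℂ) • (P *ᵥ v)) = star v ⬝ᵥ v := by
    rw [sub_mulVec, one_mulVec, smul_mulVec, sub_eq_zero] at hv
    rw [← hv]
  have e2 := (posSemidef_cpMap X hs.2).dotProduct_mulVec_nonneg v
  have e3 := h.dotProduct_mulVec_nonneg v
  have e4 := PosDef.dotProduct_mulVec_pos hX hv0
  have e5 : cpMap X 1 = ∑ j, X j * (X j)ᴴ := by simp [cpMap_apply]
  rw [← e5] at e4
  simp only [map_sub, map_smul, sub_mulVec, smul_mulVec, dotProduct_sub, dotProduct_smul,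
    one_mulVec, smul_eq_mul] at e1 e2 e3 e4
  replace e1 := congrArg Complex.re e1
  replace e2 := (Complex.le_def.1 e2).1
  replace e3 := (Complex.le_def.1 e3).1
  replace e4 := (Complex.lt_def.1 e4).1
  simp only [Complex.sub_re, Complex.re_ofReal_mul, Complex.zero_re] at e1 e2 e3 e4
  have e6 : 0 < (star v ⬝ᵥ v).re := (Complex.lt_def.1 (dotProduct_star_self_pos_iff.2 hv0)).1
  by_contra! ht1
  nlinarith [mul_le_mul_of_nonneg_left e3 hs.1, mul_nonneg (sub_nonneg.2 ht1) e6.le]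

/-- Perron–Frobenius for the positive map associated to a generic point of the free ball. -/
theorem IsGeneric.exists_posDef_eigenvector {d n : ℕ} {X : MatTuple d n} (hX : IsGeneric X)
    (hn : 1 ≤ n) (hball : X ∈ freeBall d n) :
    ∃ P : Matrix (Fin n) (Fin n) ℂ, P.PosDef ∧
      ∃ t : ℝ, 0 ≤ t ∧ t < 1 ∧ cpMap X P = (t : ℂ) • P := by
  have : Nonempty (Fin n) := ⟨⟨0, hn⟩⟩
  let K : Set (Matrix (Fin n) (Fin n) ℂ × ℝ) :=
    {p | ‖p.1‖ = 1 ∧ p.1.PosSemidef ∧ 0 ≤ p.2 ∧ (cpMap X p.1 - (p.2 : ℂ) • p.1).PosSemidef}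
  have hcp := continuous_cpMap X
  have hKclosed : IsClosed K := by
    have h1 : IsClosed {p : Matrix (Fin n) (Fin n) ℂ × ℝ | ‖p.1‖ = 1} :=
      isClosed_eq (by fun_prop) (by fun_prop)
    have h2 : IsClosed {p : Matrix (Fin n) (Fin n) ℂ × ℝ | 0 ≤ p.2} :=
      isClosed_le (by fun_prop) (by fun_prop)
    exact h1.inter (((isClosed_posSemidef n).preimage continuous_fst).inter (h2.inter
      ((isClosed_posSemidef n).preimage (f := fun p : Matrix (Fin n) (Fin n) ℂ × ℝ =>
        cpMap X p.1 - (p.2 : ℂ) • p.1) (by fun_prop))))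
  have hne0 : ∀ P : Matrix (Fin n) (Fin n) ℂ, ‖P‖ = 1 → P ≠ 0 := by
    rintro P hP rfl
    simp at hP
  have hKsub : K ⊆ Metric.sphere 0 1 ×ˢ Set.Icc 0 1 := fun p hp =>
    ⟨by simpa using hp.1, hp.2.2.1,
      (lt_one_of_posSemidef_cpMap_sub hball hp.2.1 (hne0 _ hp.1) hp.2.2.1 hp.2.2.2).le⟩
  have : ProperSpace (Matrix (Fin n) (Fin n) ℂ) := FiniteDimensional.proper ℂ _
  have hKc : IsCompact K :=
    ((isCompact_sphere _ _).prod isCompact_Icc).of_isClosed_subset hKclosed hKsub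
  have normalize : ∀ (P : Matrix (Fin n) (Fin n) ℂ) (t : ℝ), P ≠ 0 → P.PosSemidef → 0 ≤ t →
      (cpMap X P - (t : ℂ) • P).PosSemidef → (((‖P‖⁻¹ : ℝ) : ℂ) • P, t) ∈ K := by
    intro P t h0 hP ht h
    have hpos : (0 : ℂ) ≤ ((‖P‖⁻¹ : ℝ) : ℂ) := by
      exact_mod_cast inv_nonneg.2 (norm_nonneg P)
    refine ⟨?_, hP.smul hpos, ht, ?_⟩
    · simp [norm_smul, h0]
    · have := h.smul hpos
      rw [smul_sub, smul_comm, ← map_smul] at this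
      exact this
  have hKne : K.Nonempty :=
    ⟨_, normalize 1 0 one_ne_zero PosSemidef.one le_rfl
      (by simpa using posSemidef_cpMap X PosSemidef.one)⟩
  obtain ⟨⟨P, t⟩, ⟨hP1, hP, ht, hPt⟩, hmax⟩ := hKc.exists_isMaxOn hKne continuousOn_snd
  simp only at hP1 hP ht hPt
  have hP0 := hne0 P hP1
  have ht1 := lt_one_of_posSemidef_cpMap_sub hball hP hP0 ht hPt
  have heig : cpMap X P = (t : ℂ) • P := by
    by_contra hcon
    obtain ⟨N, hN⟩ := hX.exists_posDef_pow hPt (sub_ne_zero.2 hcon)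
    have hcomm : ∀ M, ((1 + cpMap X) ^ N) (cpMap X M) = cpMap X (((1 + cpMap X) ^ N) M) := by
      intro M
      have : Commute ((1 + cpMap X) ^ N) (cpMap X) :=
        ((Commute.one_left _).add_left (Commute.refl _)).pow_left N
      exact LinearMap.congr_fun this.eq M
    rw [map_sub, map_smul, hcomm] at hN
    set P' := ((1 + cpMap X) ^ N) P with hP'
    have hP'psd : P'.PosSemidef := posSemidef_one_add_cpMap_pow X hP N
    have hP'0 : P' ≠ 0 := by
      intro h0
      rw [h0] at hN
      simpa using hN.diag_pos (i := ⟨0, hn⟩)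
    have hev := eventually_posDef (h := fun s : ℝ => cpMap X P' - (s : ℂ) • P') (by fun_prop)
      (fun s => by
        have h1 := (posSemidef_cpMap X hP'psd).1
        simp [IsHermitian, h1.eq, hP'psd.1.eq]) hN
    obtain ⟨u, hu, hu'⟩ := ((hev.filter_mono nhdsWithin_le_nhds).and
      (self_mem_nhdsWithin : Set.Ioi t ∈ nhdsWithin t (Set.Ioi t))).exists
    exact absurd hu' (not_lt.2 (hmax (normalize P' u hP'0 hP'psd (ht.trans (le_of_lt hu'))
      hu.posSemidef)))
  refine ⟨P, ?_, t, ht, ht1, heig⟩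
  obtain ⟨N, hN⟩ := hX.exists_posDef_pow hP hP0
  have hpow : ((1 + cpMap X) ^ N) P = (((1 + t) ^ N : ℝ) : ℂ) • P := by
    clear hN
    induction N with
    | zero => simp
    | succ N ih =>
      rw [pow_succ', Module.End.mul_apply, ih, map_smul, LinearMap.add_apply, heig,
        Module.End.one_apply]
      push_cast
      module
  have hpos : (0 : ℝ) < (1 + t) ^ N := by positivity
  have hc : (0 : ℂ) < ((((1 + t) ^ N)⁻¹ : ℝ) : ℂ) := by exact_mod_cast inv_pos.2 hpos
  have := hN.smul hc
  rw [hpow, smul_smul, ← Complex.ofReal_mul, inv_mul_cancel₀ hpos.ne'] at this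
  simpa using this

/-- A generic point of the free ball with a nonzero coordinate is similar to a scalar multiple
of a row coisometry. -/
theorem IsGeneric.exists_similar_coisometry {d n : ℕ} {X : MatTuple d n} (hX : IsGeneric X)
    (hn : 1 ≤ n) (hball : X ∈ freeBall d n) (hX0 : X ≠ 0) :
    ∃ (S : Matrix (Fin n) (Fin n) ℂ) (r : ℝ) (U : MatTuple d n), IsUnit S ∧ 0 < r ∧ r < 1 ∧
      ∑ j, U j * (U j)ᴴ = 1 ∧ (fun j => S⁻¹ * X j * S) = (r : ℂ) • U := by
  obtain ⟨P, hP, t, ht, ht1, heig⟩ := hX.exists_posDef_eigenvector hn hball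
  obtain ⟨B, hB⟩ := exists_eq_conjTranspose_mul_self_of_posSemidef hP.posSemidef
  have hS : IsUnit Bᴴ := by
    have := hP.isUnit
    rw [hB, isUnit_iff_isUnit_det, det_mul] at this
    exact (isUnit_iff_isUnit_det _).2 (isUnit_of_mul_isUnit_left this)
  have hSi : Bᴴ⁻¹ * Bᴴ = 1 := nonsing_inv_mul _ ((isUnit_iff_isUnit_det _).1 hS)
  have hSi' : B * B⁻¹ = 1 := by
    have := congrArg conjTranspose hSi
    simpa [conjTranspose_nonsing_inv] using this
  have hSi'' : Bᴴ * Bᴴ⁻¹ = 1 := mul_nonsing_inv _ ((isUnit_iff_isUnit_det _).1 hS)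
  set Y : MatTuple d n := fun j => Bᴴ⁻¹ * X j * Bᴴ with hY
  have hYY : ∑ j, Y j * (Y j)ᴴ = (t : ℂ) • 1 := by
    have h1 : ∀ j, Y j * (Y j)ᴴ = Bᴴ⁻¹ * (X j * P * (X j)ᴴ) * B⁻¹ := by
      intro j
      simp only [hY, hB, conjTranspose_mul, conjTranspose_nonsing_inv, conjTranspose_conjTranspose]
      noncomm_ring
    simp only [h1]
    rw [← Finset.sum_mul, ← Finset.mul_sum, ← cpMap_apply, heig, hB]
    simp only [mul_smul_comm, smul_mul_assoc]
    rw [← mul_assoc, hSi, one_mul, hSi']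
  have htpos : 0 < t := by
    refine lt_of_le_of_ne ht fun h0 => hX0 ?_
    have h1 : entries d n Y = 0 := by
      rw [← norm_eq_zero, ← sq_eq_zero_iff, norm_entries_sq, hYY, ← h0]
      simp
    have h2 : Y = 0 := entries_injective d n (by rw [h1, map_zero])
    ext1 j
    calc X j = Bᴴ * Y j * Bᴴ⁻¹ := by
          simp only [hY]
          rw [mul_assoc, mul_assoc (Bᴴ⁻¹ * X j), hSi'', mul_one, ← mul_assoc, hSi'', one_mul]
      _ = 0 := by simp [h2]
  have hr : 0 < √t := Real.sqrt_pos.2 htpos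
  have hrc : ((√t : ℝ) : ℂ) ≠ 0 := by exact_mod_cast hr.ne'
  refine ⟨Bᴴ, √t, ((√t : ℝ) : ℂ)⁻¹ • Y, hS, hr, ?_, ?_, ?_⟩
  · rw [Real.sqrt_lt' one_pos]; simpa using ht1
  · simp only [Pi.smul_apply, conjTranspose_smul, smul_mul_smul_comm, ← Finset.smul_sum, hYY,
      smul_smul]
    have : ((√t : ℝ) : ℂ)⁻¹ * star ((√t : ℝ) : ℂ)⁻¹ * (t : ℂ) = 1 := by
      rw [star_inv₀, RCLike.star_def, Complex.conj_ofReal, ← mul_inv, ← Complex.ofReal_mul,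
        Real.mul_self_sqrt ht]
      exact inv_mul_cancel₀ (by exact_mod_cast htpos.ne')
    rw [this, one_smul]
  · rw [smul_smul, mul_inv_cancel₀ hrc, one_smul]

namespace NCSelfMap

variable {d : ℕ}

theorem app_zero (f : NCSelfMap d) (hf0 : f.app 1 0 = 0) (n : ℕ) : f.app n 0 = 0 := by
  have hsum : ∀ k, dSum (0 : MatTuple d k) (0 : MatTuple d 1) = 0 := by
    intro k
    ext1 j
    simp [dSum]
  induction n with
  | zero => exact Subsingleton.elim _ _
  | succ k ih =>
    have := f.map_dSum (0 : MatTuple d k) (0 : MatTuple d 1) (zero_mem_freeBall d k)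
      (zero_mem_freeBall d 1)
    rwa [ih, hf0, hsum] at this

theorem differentiableAt_zero (f : NCSelfMap d) (n : ℕ) : DifferentiableAt ℂ (f.app n) 0 :=
  (f.holo n).differentiableAt (freeBall_mem_nhds_zero d n)

theorem hasDerivAt_smul (f : NCSelfMap d) {n : ℕ} (Z : MatTuple d n) :
    HasDerivAt (fun z : ℂ => f.app n (z • Z)) (fderiv ℂ (f.app n) 0 Z) 0 := by
  have h1 : HasDerivAt (fun z : ℂ => z • Z) Z 0 := by
    have h := (hasDerivAt_id (0 : ℂ)).smul_const Z
    rw [one_smul] at h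
    exact h
  have h2 : HasFDerivAt (f.app n) (fderiv ℂ (f.app n) 0) ((0 : ℂ) • Z) := by
    rw [zero_smul]
    exact (f.differentiableAt_zero n).hasFDerivAt
  exact h2.comp_hasDerivAt 0 h1

theorem eventually_smul_mem {n : ℕ} (Z : MatTuple d n) :
    ∀ᶠ z : ℂ in nhds 0, z • Z ∈ freeBall d n := by
  have : Filter.Tendsto (fun z : ℂ => z • Z) (nhds 0) (nhds 0) := by
    have h : Continuous fun z : ℂ => z • Z := by fun_prop
    simpa using h.tendsto 0
  exact this.eventually (freeBall_mem_nhds_zero d n)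

/-- If an nc map intertwines along a linear map near the origin, so does its derivative. -/
theorem fderiv_comm (f : NCSelfMap d) {n m : ℕ} (T : MatTuple d n →ₗ[ℂ] MatTuple d m)
    (Z : MatTuple d n)
    (h : ∀ᶠ z : ℂ in nhds 0, f.app m (z • T Z) = T (f.app n (z • Z))) :
    fderiv ℂ (f.app m) 0 (T Z) = T (fderiv ℂ (f.app n) 0 Z) := by
  have h1 := (f.hasDerivAt_smul Z)
  have h2 := (LinearMap.toContinuousLinearMap T).hasFDerivAt.comp_hasDerivAt (0 : ℂ) h1
  have h3 := (f.hasDerivAt_smul (T Z)).congr_of_eventuallyEq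
    (f₁ := fun z => T (f.app n (z • Z))) (h.mono fun z hz => hz.symm)
  exact h3.unique h2

theorem fderiv_conj (f : NCSelfMap d) {n : ℕ} {S : Matrix (Fin n) (Fin n) ℂ} (hS : IsUnit S)
    (Z : MatTuple d n) :
    fderiv ℂ (f.app n) 0 (fun j => S⁻¹ * Z j * S) =
      fun j => S⁻¹ * fderiv ℂ (f.app n) 0 Z j * S := by
  let T : MatTuple d n →ₗ[ℂ] MatTuple d n :=
    { toFun := fun Z j => S⁻¹ * Z j * S
      map_add' := fun _ _ => by ext1 j; simp [mul_add, add_mul]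
      map_smul' := fun _ _ => by ext1 j; simp }
  refine f.fderiv_comm T Z ?_
  filter_upwards [eventually_smul_mem Z, eventually_smul_mem (T Z)] with z h1 h2
  rw [← map_smul] at h2 ⊢
  exact f.map_sim (z • Z) S h1 hS h2

theorem fderiv_dSum (f : NCSelfMap d) (hf0 : f.app 1 0 = 0) (k : ℕ) (Y : MatTuple d 1) :
    fderiv ℂ (f.app (k + 1)) 0 (dSum 0 Y) = dSum 0 (fderiv ℂ (f.app 1) 0 Y) := by
  let T : MatTuple d 1 →ₗ[ℂ] MatTuple d (k + 1) :=
    { toFun := fun Y => dSum 0 Y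
      map_add' := fun _ _ => by
        ext1 j
        rw [← sub_eq_zero]
        ext a b
        refine Fin.addCases (fun a => ?_) (fun a => ?_) a <;>
        refine Fin.addCases (fun b => ?_) (fun b => ?_) b <;> simp [dSum]
      map_smul' := fun _ _ => by
        ext j a b
        refine Fin.addCases (fun a => ?_) (fun a => ?_) a <;>
        refine Fin.addCases (fun b => ?_) (fun b => ?_) b <;> simp [dSum] }
  refine f.fderiv_comm T Y ?_
  filter_upwards [eventually_smul_mem Y] with z h1
  have := f.map_dSum (0 : MatTuple d k) (z • Y) (zero_mem_freeBall d k) h1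
  rw [f.app_zero hf0] at this
  rw [← map_smul]
  exact this

/-- The derivative at the origin of an nc map is an ampliation of its level-one derivative. -/
theorem fderiv_ampliation (f : NCSelfMap d) (hf0 : f.app 1 0 = 0) (n : ℕ) (v : Fin d → ℂ)
    (M : Matrix (Fin n) (Fin n) ℂ) :
    fderiv ℂ (f.app n) 0 (fun j => v j • M) =
      fun j => (fderiv ℂ (f.app 1) 0 (scalarPt d 1 v) j 0 0) • M := by
  cases n with
  | zero => exact Subsingleton.elim _ _
  | succ k =>
    set w : Fin d → ℂ := fun j => fderiv ℂ (f.app 1) 0 (scalarPt d 1 v) j 0 0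
    let D : (Fin d → ℂ) → Matrix (Fin (k + 1)) (Fin (k + 1)) ℂ →ₗ[ℂ] MatTuple d (k + 1) := fun u =>
      { toFun := fun M j => u j • M
        map_add' := fun _ _ => by ext1 j; simp
        map_smul' := fun _ _ => by ext1 j; exact smul_comm _ _ _ }
    let K : Submodule ℂ (Matrix (Fin (k + 1)) (Fin (k + 1)) ℂ) :=
      LinearMap.eqLocus ((fderiv ℂ (f.app (k + 1)) 0 : _ →ₗ[ℂ] _).comp (D v)) (D w)
    have hconj : ∀ S : Matrix (Fin (k + 1)) (Fin (k + 1)) ℂ, IsUnit S → ∀ M ∈ K,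
        S⁻¹ * M * S ∈ K := by
      intro S hS M hM
      have h1 := f.fderiv_conj hS (D v M)
      have hM' : fderiv ℂ (f.app (k + 1)) 0 (D v M) = D w M := hM
      rw [hM'] at h1
      change fderiv ℂ (f.app (k + 1)) 0 (D v (S⁻¹ * M * S)) = D w (S⁻¹ * M * S)
      have e : ∀ u, D u (S⁻¹ * M * S) = fun j => S⁻¹ * D u M j * S := by
        intro u; ext1 j; simp [D]
      rw [e v, e w, h1]
    have hlast : single (Fin.last k) (Fin.last k) (1 : ℂ) ∈ K := by
      have e : ∀ Y : MatTuple d 1, dSum (0 : MatTuple d k) Y =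
          D (fun j => Y j 0 0) (single (Fin.last k) (Fin.last k) (1 : ℂ)) := by
        intro Y
        ext j a b
        refine Fin.addCases (fun a => ?_) (fun a => ?_) a <;>
        refine Fin.addCases (fun b => ?_) (fun b => ?_) b
        · have : Fin.last k ≠ Fin.castAdd 1 a := (Fin.castSucc_lt_last a).ne'
          simp [dSum, D, this]
        · have : Fin.last k ≠ Fin.castAdd 1 a := (Fin.castSucc_lt_last a).ne'
          simp [dSum, D, this]
        · have : Fin.last k ≠ Fin.castAdd 1 b := (Fin.castSucc_lt_last b).ne'
          simp [dSum, D, this]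
        · obtain rfl := Subsingleton.elim a 0
          obtain rfl := Subsingleton.elim b 0
          have : Fin.natAdd k (0 : Fin 1) = Fin.last k := rfl
          simp [dSum, D, this]
      have h1 := f.fderiv_dSum hf0 k (scalarPt d 1 v)
      rw [e, e] at h1
      have h2 : (fun j => scalarPt d 1 v j 0 0) = v := by ext j; simp [scalarPt]
      rw [h2] at h1
      exact h1
    have htransv : ∀ a b : Fin (k + 1), a ≠ b → ∀ M ∈ K,
        (1 - single a b (1 : ℂ)) * M * (1 + single a b 1) ∈ K := by
      intro a b hab M hM
      have h1 : (1 - single a b (1 : ℂ)) * (1 + single a b 1) = 1 := by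
        simp [sub_mul, mul_add, hab.symm]
      have h2 := hconj (1 + single a b 1)
        ((isUnit_iff_isUnit_det _).2 (isUnit_det_of_left_inverse h1)) M hM
      rwa [inv_eq_left_inv h1] at h2
    have hoff : ∀ i j, i ≠ j → single j j (1 : ℂ) ∈ K → single i j (1 : ℂ) ∈ K := by
      intro i j hij hj
      have h1 := K.sub_mem hj (htransv i j hij _ hj)
      have h2 : (1 - single i j (1 : ℂ)) * single j j 1 * (1 + single i j 1) =
          single j j 1 - single i j 1 := by
        simp [sub_mul, mul_add, hij.symm]
      rwa [h2, sub_sub_cancel] at h1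
    have hdiag : ∀ i, single i i (1 : ℂ) ∈ K := by
      intro i
      by_cases hi : i = Fin.last k
      · exact hi ▸ hlast
      have h1 := hoff i _ hi hlast
      have h2 := K.sub_mem (htransv _ i (Ne.symm hi) _ hlast) hlast
      have h3 := K.add_mem (K.add_mem (K.sub_mem (htransv _ i (Ne.symm hi) _ h1) h1) hlast) h2
      have h4 : (1 - single (Fin.last k) i (1 : ℂ)) * single i (Fin.last k) 1 *
          (1 + single (Fin.last k) i 1) - single i (Fin.last k) 1 +
          single (Fin.last k) (Fin.last k) 1 +
          ((1 - single (Fin.last k) i 1) * single (Fin.last k) (Fin.last k) 1 *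
          (1 + single (Fin.last k) i 1) - single (Fin.last k) (Fin.last k) 1) = single i i 1 := by
        simp [sub_mul, mul_add, hi]
        abel
      rwa [h4] at h3
    have htop : M ∈ K := by
      rw [matrix_eq_sum_single M]
      refine Submodule.sum_mem _ fun i _ => Submodule.sum_mem _ fun j _ => ?_
      have hij : single i j (1 : ℂ) ∈ K := by
        by_cases h : i = j
        · exact h ▸ hdiag i
        · exact hoff i j h (hdiag j)
      have := K.smul_mem (M i j) hij
      simpa [smul_single] using this
    exact htop

/-- Equality in the Schwarz lemma along the disc spanned by a row coisometry. -/
theorem app_smul_of_dslope_eq (f : NCSelfMap d) (hf0 : f.app 1 0 = 0) {n : ℕ} {U : MatTuple d n}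
    (hU : ∑ j, U j * (U j)ᴴ = 1) {z₀ : ℂ} (hz₀ : ‖z₀‖ < 1)
    (h : dslope (fun z : ℂ => entries d n (f.app n (z • U))) 0 z₀ = entries d n U)
    {z : ℂ} (hz : ‖z‖ < 1) : f.app n (z • U) = z • U := by
  set g : ℂ → EuclideanSpace ℂ (Fin d × Fin n × Fin n) :=
    fun z => entries d n (f.app n (z • U)) with hg
  have hmem : ∀ z ∈ Metric.ball (0 : ℂ) 1, z • U ∈ freeBall d n := fun z hz =>
    smul_mem_freeBall hU (by simpa using hz)
  have hg0 : g 0 = 0 := by simp [hg, f.app_zero hf0]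
  have hd : DifferentiableOn ℂ g (Metric.ball 0 1) := by
    refine (entries d n).differentiable.comp_differentiableOn ?_
    exact (f.holo n).comp (by fun_prop) hmem
  have hmaps : Set.MapsTo g (Metric.ball 0 1) (Metric.closedBall (g 0) √n) := by
    intro z hz
    rw [hg0, mem_closedBall_zero_iff]
    exact norm_entries_le (f.mapsTo n (hmem z hz))
  have key := Complex.affine_of_mapsTo_ball_of_norm_dslope_eq_div hd hmaps
    (z₀ := z₀) (by simpa using hz₀) (by rw [h, norm_entries_of_sum_eq_one hU, div_one])
    (show z ∈ Metric.ball 0 1 by simpa using hz)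
  refine entries_injective d n ?_
  rw [map_smul]
  simpa [h, hg0] using key

theorem fderiv_eq_sum (f : NCSelfMap d) (hf0 : f.app 1 0 = 0) {n : ℕ} (Z : MatTuple d n) :
    fderiv ℂ (f.app n) 0 Z = fun j =>
      ∑ k, (fderiv ℂ (f.app 1) 0 (scalarPt d 1 (Pi.single k 1)) j 0 0) • Z k := by
  have hZ : Z = ∑ k, fun j => (Pi.single k (1 : ℂ) : Fin d → ℂ) j • Z k := by
    ext1 j
    simp [Finset.sum_apply, Pi.single_apply, ite_smul]
  conv_lhs => rw [hZ, map_sum]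
  ext1 j
  rw [Finset.sum_apply]
  refine Finset.sum_congr rfl fun k _ => ?_
  rw [f.fderiv_ampliation hf0]

/-- If the derivative at the origin fixes a tuple with linearly independent coordinates, then it
is the identity at every level. -/
theorem fderiv_eq_self (f : NCSelfMap d) (hf0 : f.app 1 0 = 0) {n : ℕ} {U : MatTuple d n}
    (hU : LinearIndependent ℂ U) (h : fderiv ℂ (f.app n) 0 U = U) {m : ℕ} (Z : MatTuple d m) :
    fderiv ℂ (f.app m) 0 Z = Z := by
  have ha : ∀ j k, fderiv ℂ (f.app 1) 0 (scalarPt d 1 (Pi.single k 1)) j 0 0 =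
      (Pi.single j (1 : ℂ) : Fin d → ℂ) k := by
    intro j k
    have h1 := congrFun (f.fderiv_eq_sum hf0 U) j
    rw [h] at h1
    have h2 : ∑ k, (fderiv ℂ (f.app 1) 0 (scalarPt d 1 (Pi.single k 1)) j 0 0 -
        (Pi.single j (1 : ℂ) : Fin d → ℂ) k) • U k = 0 := by
      simp only [sub_smul, Finset.sum_sub_distrib]
      rw [← h1]
      simp [Pi.single_apply, ite_smul]
    exact sub_eq_zero.1 (Fintype.linearIndependent_iff.1 hU _ h2 k)
  rw [f.fderiv_eq_sum hf0]
  ext1 j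
  simp [ha, Pi.single_apply, ite_smul]

/-- An nc self-map tangent to the identity fixes the multiples of row coisometries. -/
theorem app_smul_of_fderiv_eq_self (f : NCSelfMap d) (hf0 : f.app 1 0 = 0) {n : ℕ}
    {U : MatTuple d n} (hU : ∑ j, U j * (U j)ᴴ = 1) (h : fderiv ℂ (f.app n) 0 U = U)
    {z : ℂ} (hz : ‖z‖ < 1) : f.app n (z • U) = z • U := by
  refine f.app_smul_of_dslope_eq hf0 hU (z₀ := 0) (by simp) ?_ hz
  have h1 := (entries d n).hasFDerivAt.comp_hasDerivAt (0 : ℂ) (f.hasDerivAt_smul U)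
  rw [dslope_same]
  exact h1.deriv.trans (congrArg (entries d n) h)

end NCSelfMap

theorem sum_mul_diagonal_mul {d m : ℕ} {W : MatTuple d m} (hW : ∑ j, W j * (W j)ᴴ = 1)
    (V : Matrix (Fin m) (Fin m) ℂ) (c : Fin m → ℂ) :
    ∑ j, (V * diagonal c * W j) * (V * diagonal c * W j)ᴴ =
      V * diagonal (fun i => ((‖c i‖ ^ 2 : ℝ) : ℂ)) * Vᴴ := by
  have h : ∀ j, (V * diagonal c * W j) * (V * diagonal c * W j)ᴴ =
      V * diagonal c * (W j * (W j)ᴴ) * (V * diagonal c)ᴴ := by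
    intro j
    rw [conjTranspose_mul _ (W j)]
    noncomm_ring
  simp only [h]
  rw [← Finset.sum_mul, ← Finset.mul_sum, hW, mul_one, conjTranspose_mul, diagonal_conjTranspose,
    mul_assoc V, ← mul_assoc (diagonal c), diagonal_mul_diagonal, ← mul_assoc]
  congr 3
  ext i
  simp [Complex.mul_conj, Complex.normSq_eq_norm_sq]

theorem mul_diagonal_mul_mem_freeBall {d m : ℕ} {W : MatTuple d m}
    (hW : ∑ j, W j * (W j)ᴴ = 1) {V : Matrix (Fin m) (Fin m) ℂ} (hV : V * Vᴴ = 1)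
    {c : Fin m → ℂ} (hc : ∀ i, ‖c i‖ < 1) :
    (fun j => V * diagonal c * W j) ∈ freeBall d m := by
  have h1 : (diagonal fun i => ((1 - ‖c i‖ ^ 2 : ℝ) : ℂ)).PosDef := by
    refine PosDef.diagonal fun i => ?_
    have : ‖c i‖ ^ 2 < 1 := by nlinarith [norm_nonneg (c i), hc i]
    exact_mod_cast sub_pos.2 this
  have hu : IsUnit V := (isUnit_iff_isUnit_det _).2 (isUnit_det_of_right_inverse hV)
  have h2 := h1.mul_mul_conjTranspose_same (B := V) (vecMul_injective_of_isUnit hu)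
  rw [freeBall, Set.mem_ofPred_eq, sum_mul_diagonal_mul hW]
  convert h2 using 1
  have h3 : (diagonal fun i => ((1 - ‖c i‖ ^ 2 : ℝ) : ℂ)) =
      1 - diagonal (fun i => ((‖c i‖ ^ 2 : ℝ) : ℂ)) := by
    rw [← diagonal_one, diagonal_sub]
    congr 1
    ext i
    push_cast
    rfl
  rw [h3, mul_sub, sub_mul, mul_one, hV]

theorem one_add_ofReal_mul_ne_zero {s : ℝ} (hs0 : 0 ≤ s) (hs1 : s < 1) {z : ℂ} (hz : ‖z‖ ≤ 1) :
    1 + (s : ℂ) * z ≠ 0 := by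
  intro h
  have h1 : (s : ℂ) * z = -1 := by linear_combination h
  have h2 := congrArg norm h1
  simp only [norm_mul, Complex.norm_real, Real.norm_of_nonneg hs0, norm_neg, norm_one] at h2
  nlinarith [norm_nonneg z]

theorem norm_sq_add_ofReal_sub (s : ℝ) (z : ℂ) :
    ‖1 + (s : ℂ) * z‖ ^ 2 - ‖(s : ℂ) + z‖ ^ 2 = (1 - s ^ 2) * (1 - ‖z‖ ^ 2) := by
  simp only [← Complex.normSq_eq_norm_sq, Complex.normSq_apply]
  simp
  ring

theorem norm_moebius_le_one {s : ℝ} (hs0 : 0 ≤ s) (hs1 : s < 1) {z : ℂ} (hz : ‖z‖ ≤ 1) :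
    ‖((s : ℂ) + z) / (1 + s * z)‖ ≤ 1 := by
  have h0 := norm_pos_iff.2 (one_add_ofReal_mul_ne_zero hs0 hs1 hz)
  rw [norm_div, div_le_one h0]
  refine le_of_sq_le_sq ?_ h0.le
  rw [← sub_nonneg, norm_sq_add_ofReal_sub]
  exact mul_nonneg (by nlinarith) (by nlinarith [norm_nonneg z])

theorem norm_moebius_eq_one {s : ℝ} (hs0 : 0 ≤ s) (hs1 : s < 1) {z : ℂ} (hz : ‖z‖ = 1) :
    ‖((s : ℂ) + z) / (1 + s * z)‖ = 1 := by
  have h0 := norm_pos_iff.2 (one_add_ofReal_mul_ne_zero hs0 hs1 hz.le)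
  rw [norm_div, div_eq_one_iff_eq h0.ne', ← sq_eq_sq₀ (norm_nonneg _) h0.le, eq_comm,
    ← sub_eq_zero, norm_sq_add_ofReal_sub, hz]
  ring

namespace NCSelfMap

variable {d : ℕ}

/-- A nondegenerate point of the ball is the centre of an analytic disc whose boundary consists
of multiples of row coisometries. -/
theorem app_eq_self_of_posDef (f : NCSelfMap d) {m : ℕ}
    (hf : ∀ U : MatTuple d m, ∑ j, U j * (U j)ᴴ = 1 → ∀ z : ℂ, ‖z‖ < 1 →
      f.app m (z • U) = z • U)
    {Z : MatTuple d m} (hZ : Z ∈ freeBall d m) (hpos : (∑ j, Z j * (Z j)ᴴ).PosDef) :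
    f.app m Z = Z := by
  set M := ∑ j, Z j * (Z j)ᴴ with hM
  set l : Fin m → ℝ := hpos.1.eigenvalues
  set V : Matrix (Fin m) (Fin m) ℂ := hpos.1.eigenvectorUnitary.1
  have hVV : V * Vᴴ = 1 := Unitary.coe_mul_star_self hpos.1.eigenvectorUnitary
  have hVV' : Vᴴ * V = 1 := Unitary.coe_star_mul_self hpos.1.eigenvectorUnitary
  have hspec : Vᴴ * M * V = diagonal fun i => (l i : ℂ) := by
    have h := hpos.1.conjStarAlgAut_star_eigenvectorUnitary
    rw [Unitary.conjStarAlgAut_star_apply] at h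
    exact h
  have hlpos : ∀ i, 0 < l i := hpos.eigenvalues_pos
  have hl1 : ∀ i, l i < 1 := by
    have hu : IsUnit V := (isUnit_iff_isUnit_det _).2 (isUnit_det_of_right_inverse hVV)
    have h := PosDef.conjTranspose_mul_mul_same hZ (B := V) (mulVec_injective_of_isUnit hu)
    rw [← hM, mul_sub, sub_mul, mul_one, hVV', hspec, ← diagonal_one, diagonal_sub,
      posDef_diagonal_iff] at h
    intro i
    have := h i
    rw [sub_pos] at this
    exact_mod_cast this
  obtain ⟨r, hr, hr0, hr1⟩ : ∃ r : ℝ, (∀ i, √(l i) < r) ∧ 0 < r ∧ r < 1 := by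
    have h1 : ∀ i, ∀ᶠ r in nhdsWithin (1 : ℝ) (Set.Iio 1), √(l i) < r := fun i =>
      (lt_mem_nhds ((Real.sqrt_lt' one_pos).2 (by simpa using hl1 i))).filter_mono
        nhdsWithin_le_nhds
    have h2 : ∀ᶠ r in nhdsWithin (1 : ℝ) (Set.Iio 1), 0 < r :=
      (lt_mem_nhds one_pos).filter_mono nhdsWithin_le_nhds
    exact ((Filter.eventually_all.2 h1).and (h2.and self_mem_nhdsWithin)).exists
  set s : Fin m → ℝ := fun i => √(l i) / r with hs
  have hs0 : ∀ i, 0 ≤ s i := fun i => by positivity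
  have hs1 : ∀ i, s i < 1 := fun i => (div_lt_one hr0).2 (hr i)
  have hsq : ∀ i, ((√(l i) : ℝ) : ℂ) ≠ 0 := fun i => by
    exact_mod_cast (Real.sqrt_pos.2 (hlpos i)).ne'
  have hrc : (r : ℂ) ≠ 0 := by exact_mod_cast hr0.ne'
  set W : MatTuple d m := fun j => (diagonal fun i => ((√(l i) : ℝ) : ℂ)⁻¹) * Vᴴ * Z j with hWdef
  have hW : ∑ j, W j * (W j)ᴴ = 1 := by
    have h1 : ∀ j, W j * (W j)ᴴ = (diagonal fun i => ((√(l i) : ℝ) : ℂ)⁻¹) *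
        (Vᴴ * (Z j * (Z j)ᴴ) * V) * (diagonal fun i => ((√(l i) : ℝ) : ℂ)⁻¹) := by
      intro j
      have h2 : (diagonal fun i => ((√(l i) : ℝ) : ℂ)⁻¹)ᴴ =
          diagonal fun i => ((√(l i) : ℝ) : ℂ)⁻¹ := by
        rw [diagonal_conjTranspose]
        congr 1
        ext i
        simp
      simp only [hWdef, conjTranspose_mul, conjTranspose_conjTranspose, h2]
      noncomm_ring
    simp only [h1]
    rw [← Finset.sum_mul, ← Finset.mul_sum, ← Finset.sum_mul, ← Finset.mul_sum, ← hM, hspec,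
      diagonal_mul_diagonal, diagonal_mul_diagonal, ← diagonal_one]
    congr 1
    ext i
    have h2 : (l i : ℂ) = ((√(l i) : ℝ) : ℂ) * ((√(l i) : ℝ) : ℂ) := by
      rw [← Complex.ofReal_mul, Real.mul_self_sqrt (hlpos i).le]
    rw [h2, inv_mul_cancel_left₀ (hsq i), mul_inv_cancel₀ (hsq i)]
  set c : ℂ → Fin m → ℂ := fun z i => (s i + z) / (1 + s i * z) with hc
  set G : ℂ → MatTuple d m := fun z => (r : ℂ) • fun j => V * diagonal (c z) * W j with hG
  have hGmem : ∀ z ∈ Metric.closedBall (0 : ℂ) 1, G z ∈ freeBall d m := by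
    intro z hz
    have h1 : G z = fun j => V * diagonal ((r : ℂ) • c z) * W j := by
      ext1 j
      simp [hG, diagonal_smul]
    rw [h1]
    refine mul_diagonal_mul_mem_freeBall hW hVV fun i => ?_
    have h2 := norm_moebius_le_one (hs0 i) (hs1 i) (z := z) (by simpa using hz)
    rw [Pi.smul_apply, norm_smul, Complex.norm_real, Real.norm_of_nonneg hr0.le]
    exact (mul_le_of_le_one_right hr0.le h2).trans_lt hr1
  have hcd : ∀ i, DifferentiableOn ℂ (fun z => c z i) (Metric.closedBall 0 1) := by
    intro i
    refine DifferentiableOn.div (by fun_prop) (by fun_prop) fun z hz => ?_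
    exact one_add_ofReal_mul_ne_zero (hs0 i) (hs1 i) (by simpa using hz)
  have hGd : DifferentiableOn ℂ G (Metric.closedBall 0 1) := by
    refine differentiableOn_pi.2 fun j => differentiableOn_pi.2 fun a =>
      differentiableOn_pi.2 fun b => ?_
    refine DifferentiableOn.const_smul ?_ (r : ℂ)
    simp only [mul_apply (N := W j), mul_diagonal]
    refine DifferentiableOn.fun_sum fun i _ => ?_
    exact ((hcd i).const_mul _).mul_const _
  have hFd : DiffContOnCl ℂ (fun z => f.app m (G z) - G z) (Metric.ball 0 1) := by
    refine DifferentiableOn.diffContOnCl ?_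
    rw [closure_ball _ one_ne_zero]
    exact ((f.holo m).comp hGd hGmem).sub hGd
  have hbd : ∀ z ∈ frontier (Metric.ball (0 : ℂ) 1), ‖f.app m (G z) - G z‖ ≤ 0 := by
    intro z hz
    rw [frontier_ball _ one_ne_zero, mem_sphere_zero_iff_norm] at hz
    have h1 : ∑ j, (V * diagonal (c z) * W j) * (V * diagonal (c z) * W j)ᴴ = 1 := by
      rw [sum_mul_diagonal_mul hW]
      have h2 : ∀ i, ‖c z i‖ = 1 := fun i => norm_moebius_eq_one (hs0 i) (hs1 i) hz
      simp [h2, hVV]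
    rw [hf _ h1 r (by simpa [abs_of_pos hr0] using hr1), sub_self, norm_zero]
  have h0 := Complex.norm_le_of_forall_mem_frontier_norm_le Metric.isBounded_ball hFd hbd
    (z := 0) (subset_closure (Metric.mem_ball_self one_pos))
  have hG0 : G 0 = Z := by
    ext1 j
    have h1 : (r : ℂ) • (diagonal (c 0) * diagonal fun i => ((√(l i) : ℝ) : ℂ)⁻¹) = 1 := by
      rw [diagonal_mul_diagonal, ← diagonal_smul, ← diagonal_one]
      congr 1
      ext i
      have := hsq i
      simp only [hc, hs, Pi.smul_apply, smul_eq_mul]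
      push_cast
      field_simp
      simp [mul_comm]
    have h2 : G 0 j = V * ((r : ℂ) • (diagonal (c 0) * diagonal fun i =>
        ((√(l i) : ℝ) : ℂ)⁻¹)) * Vᴴ * Z j := by
      simp only [hG, hWdef, Pi.smul_apply, mul_smul_comm, smul_mul_assoc]
      congr 1
      noncomm_ring
    rw [h2, h1, mul_one, hVV, one_mul]
  rw [hG0] at h0
  exact sub_eq_zero.1 (norm_le_zero_iff.1 h0)

/-- An nc self-map fixing all strict multiples of row coisometries at a level is the identity
there. -/
theorem app_eq_self (f : NCSelfMap d) (j₀ : Fin d) {m : ℕ}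
    (hf : ∀ U : MatTuple d m, ∑ j, U j * (U j)ᴴ = 1 → ∀ z : ℂ, ‖z‖ < 1 →
      f.app m (z • U) = z • U)
    {Z : MatTuple d m} (hZ : Z ∈ freeBall d m) : f.app m Z = Z := by
  let p : ℂ → MatTuple d m := fun t =>
    Z + t • (Pi.single j₀ (1 : Matrix (Fin m) (Fin m) ℂ) : MatTuple d m)
  have hp : Continuous p := by fun_prop
  have hp0 : p 0 = Z := by simp [p]
  have hnear : ∀ᶠ t in nhdsWithin (0 : ℂ) {0}ᶜ, f.app m (p t) = p t := by
    have h1 : ∀ᶠ t in nhdsWithin (0 : ℂ) {0}ᶜ, p t ∈ freeBall d m :=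
      ((hp.tendsto 0).eventually (by
        rw [hp0]; exact (isOpen_freeBall d m).mem_nhds hZ)).filter_mono nhdsWithin_le_nhds
    have h2 : ∀ᶠ t in nhdsWithin (0 : ℂ) {0}ᶜ, t ∉ spectrum ℂ (-Z j₀) := by
      have hfin : (spectrum ℂ (-Z j₀) \ {0}).Finite := (finite_spectrum (-Z j₀)).subset
        Set.sdiff_subset
      filter_upwards [self_mem_nhdsWithin, mem_nhdsWithin_of_mem_nhds
        (hfin.isClosed.isOpen_compl.mem_nhds (x := (0 : ℂ)) (by simp))] with t ht ht' hmem
      exact ht' ⟨hmem, ht⟩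
    filter_upwards [h1, h2] with t ht ht'
    refine f.app_eq_self_of_posDef hf ht ?_
    have hu : IsUnit (p t j₀) := by
      have := spectrum.notMem_iff.1 ht'
      rw [sub_neg_eq_add, Algebra.algebraMap_eq_smul_one, add_comm] at this
      simpa [p] using this
    rw [← Finset.add_sum_erase _ _ (Finset.mem_univ j₀)]
    exact (PosDef.mul_conjTranspose_self _ (vecMul_injective_of_isUnit hu)).add_posSemidef
      (posSemidef_sum _ fun j _ => posSemidef_self_mul_conjTranspose _)
  have hcont : ContinuousAt (f.app m) Z :=
    ((f.holo m).differentiableAt ((isOpen_freeBall d m).mem_nhds hZ)).continuousAt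
  have hpt : Filter.Tendsto p (nhdsWithin 0 {0}ᶜ) (nhds Z) := by
    have := hp.tendsto 0
    rw [hp0] at this
    exact this.mono_left nhdsWithin_le_nhds
  exact tendsto_nhds_unique (hcont.tendsto.comp hpt) (hpt.congr' (hnear.mono fun t ht => ht.symm))

end NCSelfMap

/-- if an nc self-map fixing the origin fixes a generic point with linearly
independent coordinates, then it is the identity map. -/
theorem stmt_7 {d : ℕ} (f : NCSelfMap d) (hf0 : f.app 1 0 = 0)
    {n : ℕ} (hn : 1 ≤ n) (X : MatTuple d n) (hX : X ∈ freeBall d n)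
    (hgen : IsGeneric X) (hfix : f.app n X = X)
    (hind : LinearIndependent ℂ X) :
    ∀ m : ℕ, 1 ≤ m → ∀ Z ∈ freeBall d m, f.app m Z = Z := by
  intro m _ Z hZ
  rcases isEmpty_or_nonempty (Fin d) with hd | ⟨⟨j₀⟩⟩
  · exact Subsingleton.elim _ _
  have hX0 : X ≠ 0 := fun h => hind.ne_zero j₀ (congrFun h j₀)
  obtain ⟨S, r, U, hS, hr0, hr1, hU, hSU⟩ := hgen.exists_similar_coisometry hn hX hX0
  have hrc : (r : ℂ) ≠ 0 := by exact_mod_cast hr0.ne'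
  have hrn : ‖(r : ℂ)‖ < 1 := by simpa [abs_of_pos hr0] using hr1
  have hSS : S * S⁻¹ = 1 := mul_nonsing_inv _ ((isUnit_iff_isUnit_det _).1 hS)
  have hfixU : f.app n ((r : ℂ) • U) = (r : ℂ) • U := by
    rw [← hSU, f.map_sim X S hX hS (by rw [hSU]; exact smul_mem_freeBall hU hrn), hfix]
  have hfixdisc : ∀ z : ℂ, ‖z‖ < 1 → f.app n (z • U) = z • U := by
    refine fun z hz => f.app_smul_of_dslope_eq hf0 hU hrn ?_ hz
    rw [dslope_of_ne _ hrc, slope_def_module]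
    simp only [hfixU, zero_smul, f.app_zero hf0, map_zero, sub_zero]
    rw [map_smul, smul_smul, inv_mul_cancel₀ hrc, one_smul]
  have hderiv : fderiv ℂ (f.app n) 0 U = U := by
    have h1 : HasDerivAt (fun z : ℂ => z • U) U 0 := by
      have h := (hasDerivAt_id (0 : ℂ)).smul_const U
      rw [one_smul] at h
      exact h
    refine (f.hasDerivAt_smul U).unique (h1.congr_of_eventuallyEq ?_)
    filter_upwards [Metric.ball_mem_nhds (0 : ℂ) one_pos] with z hz
    exact hfixdisc z (by simpa using hz)
  have hUind : LinearIndependent ℂ U := by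
    rw [Fintype.linearIndependent_iff] at hind ⊢
    refine fun g hg => hind g ?_
    have h1 : ∀ j, g j • X j = S * ((r : ℂ) • g j • U j) * S⁻¹ := by
      intro j
      have h2 : S⁻¹ * X j * S = (r : ℂ) • U j := congrFun hSU j
      rw [smul_comm, ← h2, mul_smul_comm, smul_mul_assoc, ← mul_assoc, ← mul_assoc, hSS, one_mul,
        mul_assoc, hSS, mul_one]
    simp only [h1]
    rw [← Finset.sum_mul, ← Finset.mul_sum, ← Finset.smul_sum, hg, smul_zero, mul_zero, zero_mul]
  exact f.app_eq_self j₀ (fun U' hU' z hz =>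
    f.app_smul_of_fderiv_eq_self hf0 hU' (f.fderiv_eq_self hf0 hUind hderiv U') hz) hZ
end

section
/- Let V be a finite-dimensional complex normed vector space and let A : V → V be a ℂ-linear map whose powers are uniformly bounded in operator norm, i.e., there exists C > 0 with ‖A^k‖ ≤ C for all k ≥ 1. Then ker((A − id)²) = ker(A − id); in particular, the algebraic and geometric multiplicities of 1 as an eigenvalue of A coincide (A has no nontrivial Jordan block for the eigenvalue 1). -/
/-- If `A` fixes `A x - x`, then the orbit of `x` under `A` is an arithmetic progression. -/
theorem ContinuousLinearMap.pow_apply_eq_add_nsmul {R M : Type*} [Ring R] [TopologicalSpace M]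
    [AddCommGroup M] [Module R M] (A : M →L[R] M) {x : M} (h : A (A x - x) = A x - x) (k : ℕ) :
    (A ^ k) x = x + k • (A x - x) := by
  induction k with
  | zero => simp
  | succ k ih =>
    rw [pow_succ', mul_apply_eq_comp, ih, map_add, map_nsmul, h, succ_nsmul]
    abel

/-- A vector whose positive multiples are uniformly bounded in norm vanishes. -/
theorem eq_zero_of_forall_norm_nsmul_le {E : Type*} [NormedAddCommGroup E] [NormedSpace ℝ E]
    {y : E} {B : ℝ} (h : ∀ k : ℕ, 1 ≤ k → ‖k • y‖ ≤ B) : y = 0 := by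
  by_contra hy
  obtain ⟨n, hn⟩ := Archimedean.arch (B + 1) (norm_pos_iff.2 hy)
  have hle := h (n + 1) n.succ_pos
  rw [RCLike.norm_nsmul ℝ, succ_nsmul] at hle
  linarith [norm_nonneg y]

/-- a power-bounded linear operator on a finite-dimensional complex normed
space has no nontrivial Jordan block for the eigenvalue `1`:
`ker((A - id)²) = ker(A - id)`. -/
theorem stmt_9 {V : Type*} [NormedAddCommGroup V] [NormedSpace ℂ V]
    [FiniteDimensional ℂ V] (A : V →L[ℂ] V)
    (hbdd : ∃ C : ℝ, 0 < C ∧ ∀ k : ℕ, 1 ≤ k → ‖A ^ k‖ ≤ C) :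
    LinearMap.ker ((A.toLinearMap - LinearMap.id) ∘ₗ (A.toLinearMap - LinearMap.id)) =
      LinearMap.ker (A.toLinearMap - LinearMap.id) := by
  refine le_antisymm (fun x hx => ?_) (LinearMap.ker_le_ker_comp _ _)
  obtain ⟨C, -, hC⟩ := hbdd
  have hfix : A (A x - x) = A x - x := by
    simpa [sub_eq_zero] using hx
  let _ : NormedSpace ℝ V := NormedSpace.restrictScalars ℝ ℂ V
  have hzero : A x - x = 0 := by
    refine eq_zero_of_forall_norm_nsmul_le (B := C * ‖x‖ + ‖x‖) fun k hk => ?_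
    calc ‖k • (A x - x)‖ = ‖(A ^ k) x - x‖ := by
          rw [A.pow_apply_eq_add_nsmul hfix, add_sub_cancel_left]
      _ ≤ ‖(A ^ k) x‖ + ‖x‖ := norm_sub_le _ _
      _ ≤ C * ‖x‖ + ‖x‖ := by gcongr; exact (A ^ k).le_of_opNorm_le (hC k hk) x
  simpa using hzero
end

section
/- Let E be a finite-dimensional complex normed space, U ⊆ E a bounded open set, f : U → U a holomorphic self-map (f is ℂ-differentiable on U and maps U into U), and x ∈ U a fixed point of f. Then there exists C > 0 such that ‖(Df(x))^k‖ ≤ C for every k ≥ 1, where Df(x) denotes the Fréchet derivative of f at x; that is, the derivative of f at a fixed point is power bounded. -/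
/-- the derivative of a holomorphic self-map of a bounded open set at a
fixed point is power bounded. -/
theorem stmt_10 {E : Type*} [NormedAddCommGroup E] [NormedSpace ℂ E]
    [FiniteDimensional ℂ E] (U : Set E) (hU : IsOpen U) (hUb : Bornology.IsBounded U)
    (f : E → E) (hmaps : Set.MapsTo f U U) (hf : DifferentiableOn ℂ f U)
    (x : E) (hx : x ∈ U) (hfx : f x = x) :
    ∃ C : ℝ, 0 < C ∧ ∀ k : ℕ, 1 ≤ k → ‖(fderiv ℂ f x) ^ k‖ ≤ C := by
  obtain ⟨r, hr, hrU⟩ := Metric.isOpen_iff.mp hU x hx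
  obtain ⟨R, hR, hUR⟩ := hUb.subset_ball_lt 0 x
  refine ⟨R / r, div_pos hR hr, fun k _ => ?_⟩
  have hderiv : HasFDerivAt f (fderiv ℂ f x) x :=
    (hf.differentiableAt (hU.mem_nhds hx)).hasFDerivAt
  rw [← (hderiv.iterate hfx k).fderiv]
  refine Complex.norm_fderiv_le_div_of_mapsTo_ball ((hf.iterate hmaps k).mono hrU)
    (fun y hy => ?_) hr
  rw [Function.iterate_fixed hfx]
  exact Metric.ball_subset_closedBall (hUR (hmaps.iterate k (hrU hy)))
end

section
/- Let f be an nc self-map of 𝔅_d, let α ∈ 𝔅_d(1) (a vector in the open Euclidean unit ball of ℂ^d), and let α^{(n)} ∈ 𝔅_d(n) denote the scalar point (α_1·I_n, …, α_d·I_n). Then the Fréchet derivative of f_n at α^{(n)} is the ampliation of the Fréchet derivative of f₁ at α: for every d-tuple W of n×n complex matrices, every l ∈ {1,…,d}, and all indices i, k, the (i,k) entry of the l-th coordinate of Df_n(α^{(n)})(W) equals the l-th coordinate of Df₁(α) applied to the vector ((W_1)_{ik}, …, (W_d)_{ik}) ∈ ℂ^d. -/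
open Matrix
open scoped ComplexOrder

attribute [local instance] Matrix.normedAddCommGroup Matrix.normedSpace

/-- The tuple of diagonal matrices whose `i`-th diagonal entry is the vector `v i`. -/
def diagTuple {d n : ℕ} (v : Fin n → Fin d → ℂ) : MatTuple d n :=
  fun j => Matrix.diagonal fun i => v i j

theorem scalarPt_eq_diagTuple (d n : ℕ) (v : Fin d → ℂ) :
    scalarPt d n v = diagTuple fun _ => v := by
  funext j
  simp [scalarPt, diagTuple, Matrix.smul_one_eq_diagonal]

theorem diagTuple_mem_freeBall_iff {d n : ℕ} (v : Fin n → Fin d → ℂ) :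
    diagTuple v ∈ freeBall d n ↔ ∀ i, 0 < 1 - ∑ j, v i j * star (v i j) := by
  have : (1 - ∑ j, diagTuple v j * (diagTuple v j)ᴴ) =
      Matrix.diagonal fun i => 1 - ∑ j, v i j * star (v i j) := by
    ext a b
    by_cases hab : a = b
    · subst hab
      simp [diagTuple, Matrix.diagonal_conjTranspose, Matrix.sum_apply]
    · simp [diagTuple, Matrix.diagonal_conjTranspose, Matrix.sum_apply, hab]
  rw [freeBall, Set.mem_ofPred_eq, this, Matrix.posDef_diagonal_iff]

theorem diagTuple_mem_freeBall_iff_scalarPt {d n : ℕ} (v : Fin n → Fin d → ℂ) :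
    diagTuple v ∈ freeBall d n ↔ ∀ i, scalarPt d 1 (v i) ∈ freeBall d 1 := by
  simp only [scalarPt_eq_diagTuple, diagTuple_mem_freeBall_iff, forall_const]

theorem dSum_diagTuple {d n m : ℕ} (v : Fin n → Fin d → ℂ) (w : Fin m → Fin d → ℂ) :
    dSum (diagTuple v) (diagTuple w) = diagTuple (Fin.append v w) := by
  funext j
  ext a b
  refine Fin.addCases (fun a => ?_) (fun a => ?_) a <;>
    refine Fin.addCases (fun b => ?_) (fun b => ?_) b <;>
    simp [dSum, diagTuple, Matrix.diagonal_apply, Fin.ext_iff] <;> omega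

theorem NCSelfMap.app_diagTuple {d : ℕ} (f : NCSelfMap d) {n : ℕ} (v : Fin n → Fin d → ℂ)
    (hv : ∀ i, scalarPt d 1 (v i) ∈ freeBall d 1) :
    f.app n (diagTuple v) = diagTuple fun i j => f.app 1 (scalarPt d 1 (v i)) j 0 0 := by
  induction n with
  | zero => exact Subsingleton.elim _ _
  | succ n ih =>
    have hsplit : v = Fin.append (fun i : Fin n => v i.castSucc)
        (fun _ : Fin 1 => v (Fin.last n)) := by
      funext i
      refine Fin.lastCases ?_ (fun i => ?_) i
      · exact (Fin.append_right (fun i : Fin n => v i.castSucc) (fun _ => v (Fin.last n))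
          (0 : Fin 1)).symm
      · exact (Fin.append_left (fun i : Fin n => v i.castSucc) (fun _ : Fin 1 => v (Fin.last n))
          i).symm
    have hone (w : Fin d → ℂ) : f.app 1 (scalarPt d 1 w) =
        diagTuple fun _ j => f.app 1 (scalarPt d 1 w) j 0 0 := by
      funext j
      ext a b
      fin_cases a
      fin_cases b
      rfl
    have hmem : diagTuple (fun i : Fin n => v i.castSucc) ∈ freeBall d n :=
      (diagTuple_mem_freeBall_iff_scalarPt _).mpr fun i => hv _
    have key := f.map_dSum _ _ hmem (hv (Fin.last n))
    rw [ih _ fun i => hv _, hone, scalarPt_eq_diagTuple, dSum_diagTuple, dSum_diagTuple,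
      ← hsplit] at key
    rw [key]
    congr 1
    funext i
    refine Fin.lastCases ?_ (fun i => ?_) i
    · exact (Fin.append_right _ _ (0 : Fin 1)).trans (by rw [scalarPt_eq_diagTuple])
    · exact Fin.append_left _ _ i

theorem scalarPt_mem_freeBall {d : ℕ} (n : ℕ) {α : Fin d → ℂ}
    (hα : scalarPt d 1 α ∈ freeBall d 1) : scalarPt d n α ∈ freeBall d n := by
  rw [scalarPt_eq_diagTuple]
  exact (diagTuple_mem_freeBall_iff_scalarPt _).mpr fun _ => hα

theorem eventually_line_mem_freeBall {d n : ℕ} {X : MatTuple d n} (hX : X ∈ freeBall d n)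
    (W : MatTuple d n) : ∀ᶠ t : ℂ in nhds 0, X + t • W ∈ freeBall d n := by
  have hcont : Continuous fun t : ℂ => X + t • W := by fun_prop
  exact hcont.continuousAt.eventually ((isOpen_freeBall d n).mem_nhds (by simpa using hX))

theorem NCSelfMap.hasDerivAt_line {d n : ℕ} (f : NCSelfMap d) {X : MatTuple d n}
    (hX : X ∈ freeBall d n) (W : MatTuple d n) (l : Fin d) (i k : Fin n) :
    HasDerivAt (fun t : ℂ => f.app n (X + t • W) l i k) (fderiv ℂ (f.app n) X W l i k) 0 := by
  have h : HasDerivAt (fun t : ℂ => f.app n (X + t • W)) (fderiv ℂ (f.app n) X W) 0 :=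
    ((f.holo n).differentiableAt ((isOpen_freeBall d n).mem_nhds hX)).hasFDerivAt.hasLineDerivAt W
  exact hasDerivAt_pi.mp (hasDerivAt_pi.mp (hasDerivAt_pi.mp h l) i) k

theorem NCSelfMap.fderiv_scalarPt_conj {d n : ℕ} (f : NCSelfMap d) {α : Fin d → ℂ}
    (hα : scalarPt d 1 α ∈ freeBall d 1) (W : MatTuple d n) {S : Matrix (Fin n) (Fin n) ℂ}
    (hS : IsUnit S) (l : Fin d) :
    fderiv ℂ (f.app n) (scalarPt d n α) (fun j => S⁻¹ * W j * S) l =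
      S⁻¹ * fderiv ℂ (f.app n) (scalarPt d n α) W l * S := by
  have hP := scalarPt_mem_freeBall n hα
  have hconj (t : ℂ) : (fun j => S⁻¹ * (scalarPt d n α + t • W) j * S) =
      scalarPt d n α + t • fun j => S⁻¹ * W j * S := by
    have hdet := (Matrix.isUnit_iff_isUnit_det S).mp hS
    funext j
    simp [scalarPt, Matrix.mul_add, Matrix.add_mul, Matrix.nonsing_inv_mul S hdet]
  ext i k
  refine (f.hasDerivAt_line hP _ l i k).unique ?_
  have h : HasDerivAt (fun t : ℂ => (S⁻¹ * f.app n (scalarPt d n α + t • W) l * S) i k)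
      ((S⁻¹ * fderiv ℂ (f.app n) (scalarPt d n α) W l * S) i k) 0 := by
    simp only [Matrix.mul_apply]
    exact HasDerivAt.fun_sum fun b _ => HasDerivAt.mul_const
      (HasDerivAt.fun_sum fun a _ => (f.hasDerivAt_line hP W l a b).const_mul _) _
  refine h.congr_of_eventuallyEq ?_
  filter_upwards [eventually_line_mem_freeBall hP W,
    eventually_line_mem_freeBall hP fun j => S⁻¹ * W j * S] with t h₁ h₂
  rw [← hconj] at h₂ ⊢
  rw [f.map_sim _ S h₁ hS h₂]

theorem NCSelfMap.fderiv_scalarPt_single_same {d n : ℕ} (f : NCSelfMap d) {α : Fin d → ℂ}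
    (hα : scalarPt d 1 α ∈ freeBall d 1) (w : Fin d → ℂ) (a : Fin n) (l : Fin d) :
    fderiv ℂ (f.app n) (scalarPt d n α) (fun j => Matrix.single a a (w j)) l =
      Matrix.single a a (fderiv ℂ (f.app 1) (scalarPt d 1 α) (scalarPt d 1 w) l 0 0) := by
  have hP := scalarPt_mem_freeBall n hα
  have hline (t : ℂ) : scalarPt d n α + t • (fun j => Matrix.single a a (w j)) =
      diagTuple fun i => if i = a then α + t • w else α := by
    funext j
    ext i k
    by_cases hik : i = k
    · subst hik
      by_cases hia : i = a
      · simp [scalarPt, diagTuple, hia]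
      · simp [scalarPt, diagTuple, hia, Ne.symm hia]
    · have : ¬ (a = i ∧ a = k) := fun h => hik (h.1.symm.trans h.2)
      simp [scalarPt, diagTuple, hik, this]
  have hline_one (t : ℂ) : scalarPt d 1 (α + t • w) =
      scalarPt d 1 α + t • scalarPt d 1 w := by
    funext j
    simp [scalarPt, add_smul, mul_smul]
  ext i k
  refine (f.hasDerivAt_line hP _ l i k).unique ?_
  have happ : ∀ᶠ t : ℂ in nhds 0,
      f.app n (scalarPt d n α + t • (fun j => Matrix.single a a (w j))) l i k =
        if i = k then if i = a then f.app 1 (scalarPt d 1 α + t • scalarPt d 1 w) l 0 0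
          else f.app 1 (scalarPt d 1 α) l 0 0 else 0 := by
    filter_upwards [eventually_line_mem_freeBall hα (scalarPt d 1 w)] with t ht
    rw [← hline_one] at ht ⊢
    rw [hline, f.app_diagTuple _ fun i => by split_ifs <;> assumption]
    simp only [diagTuple, Matrix.diagonal_apply]
    split_ifs <;> rfl
  refine HasDerivAt.congr_of_eventuallyEq ?_ happ
  by_cases hik : i = k
  · subst hik
    by_cases hia : i = a
    · subst hia
      simpa using f.hasDerivAt_line hα (scalarPt d 1 w) l 0 0
    · simpa [hia, Ne.symm hia] using hasDerivAt_const (0 : ℂ) (f.app 1 (scalarPt d 1 α) l 0 0)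
  · have : ¬ (a = i ∧ a = k) := fun h => hik (h.1.symm.trans h.2)
    simpa [hik, Matrix.single_apply, this] using hasDerivAt_const (0 : ℂ) (0 : ℂ)

theorem NCSelfMap.fderiv_scalarPt_single {d n : ℕ} (f : NCSelfMap d) {α : Fin d → ℂ}
    (hα : scalarPt d 1 α ∈ freeBall d 1) (w : Fin d → ℂ) (a b : Fin n) (l : Fin d) :
    fderiv ℂ (f.app n) (scalarPt d n α) (fun j => Matrix.single a b (w j)) l =
      Matrix.single a b (fderiv ℂ (f.app 1) (scalarPt d 1 α) (scalarPt d 1 w) l 0 0) := by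
  rcases eq_or_ne a b with rfl | hab
  · exact f.fderiv_scalarPt_single_same hα w a l
  set S : Matrix (Fin n) (Fin n) ℂ := 1 + Matrix.single a b 1 with hS
  have hsq : S * (1 - Matrix.single a b 1) = 1 := by
    simp [hS, mul_sub, add_mul, Matrix.single_mul_single_of_ne _ _ _ _ hab.symm]
  have hinv : S⁻¹ = 1 - Matrix.single a b 1 := Matrix.inv_eq_right_inv hsq
  have hunit : IsUnit S := IsUnit.of_mul_eq_one _ hsq
  have hconj (c : ℂ) : S⁻¹ * Matrix.single a a c * S =
      Matrix.single a a c + Matrix.single a b c := by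
    rw [hinv, hS]
    simp [sub_mul, mul_add, Matrix.single_mul_single_of_ne _ _ _ _ hab.symm]
  have hsame := f.fderiv_scalarPt_single_same hα w a l
  have hsim := f.fderiv_scalarPt_conj hα (fun j => Matrix.single a a (w j)) hunit l
  have hadd : (fun j => S⁻¹ * Matrix.single a a (w j) * S) =
      (fun j => Matrix.single a a (w j)) + fun j => Matrix.single a b (w j) :=
    funext fun j => hconj (w j)
  rw [hadd, map_add, Pi.add_apply, hsame, hconj] at hsim
  exact add_left_cancel hsim

/-- the derivative of an nc self-map at a scalar point `α ⊗ I_n` is the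
ampliation of the derivative of the level-1 map at `α`. -/
theorem stmt_12 {d n : ℕ} (hn : 0 < n) (f : NCSelfMap d) (α : Fin d → ℂ)
    (hα : scalarPt d 1 α ∈ freeBall d 1) (W : MatTuple d n) (l : Fin d) (i k : Fin n) :
    fderiv ℂ (f.app n) (scalarPt d n α) W l i k =
      fderiv ℂ (f.app 1) (scalarPt d 1 α)
        (fun j => W j i k • (1 : Matrix (Fin 1) (Fin 1) ℂ)) l 0 0 := by
  have hW : W = ∑ a, ∑ b, fun j => Matrix.single a b (W j a b) := by
    funext j
    simp only [Finset.sum_apply]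
    exact Matrix.matrix_eq_sum_single (W j)
  have key : fderiv ℂ (f.app n) (scalarPt d n α) W l = Matrix.of fun a b =>
      fderiv ℂ (f.app 1) (scalarPt d 1 α) (scalarPt d 1 fun j => W j a b) l 0 0 := by
    conv_lhs => rw [hW]
    simp only [map_sum, Finset.sum_apply]
    rw [Finset.sum_congr rfl fun a _ => Finset.sum_congr rfl fun b _ =>
      f.fderiv_scalarPt_single hα (fun j => W j a b) a b l]
    exact (Matrix.matrix_eq_sum_single _).symm
  exact congrFun (congrFun key i) k
end

section
/- Let f be an nc self-map of 𝔅_d and let m be an integer with 2 ≤ m ≤ d. Suppose the fixed-point set of f₁ in 𝔅_d(1) is exactly {v ∈ 𝔅_d(1) : v_j = 0 for all j > m}. Then for every n ≥ 1, the fixed-point set of f_n in 𝔅_d(n) is exactly {X ∈ 𝔅_d(n) : X_j = 0 for all j > m}. -/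
open Matrix
open scoped ComplexOrder

attribute [local instance] Matrix.normedAddCommGroup Matrix.normedSpace

open Filter Topology Metric Set in
/-- A uniformly bounded sequence of holomorphic functions on a disc of radius `r > 1` which tends
to zero uniformly near the centre tends to zero at `1`. -/
theorem tendsto_zero_of_tendsto_zero_near_center {F : Type*} [NormedAddCommGroup F]
    [NormedSpace ℂ F] [CompleteSpace F] {g : ℕ → ℂ → F} {r δ M : ℝ} {ε : ℕ → ℝ} (hr : 1 < r)
    (hδ : 0 < δ) (hd : ∀ i, DifferentiableOn ℂ (g i) (ball 0 r))
    (hM : ∀ i, ∀ z ∈ ball (0 : ℂ) r, ‖g i z‖ ≤ M)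
    (hε : ∀ i, ∀ z ∈ ball (0 : ℂ) δ, ‖g i z‖ ≤ ε i) (hε0 : Tendsto ε atTop (𝓝 0)) :
    Tendsto (fun i => g i 1) atTop (𝓝 0) := by
  have cauchy : ∀ {ρ C : ℝ} (i k : ℕ), 0 < ρ → ρ < r → (∀ z ∈ sphere (0 : ℂ) ρ, ‖g i z‖ ≤ C) →
      ‖((k.factorial : ℂ)⁻¹) • iteratedDeriv k (g i) 0‖ ≤ C / ρ ^ k := by
    intro ρ C i k hρ hρr hC
    have h := Complex.norm_iteratedDeriv_le_of_forall_mem_sphere_norm_le k hρ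
      ((hd i).mono (by
        rw [closure_ball _ hρ.ne']
        exact closedBall_subset_ball hρr)).diffContOnCl hC
    have hk : (0 : ℝ) < k.factorial := by positivity
    rw [norm_smul, norm_inv, Complex.norm_natCast, inv_mul_le_iff₀ hk]
    exact h.trans_eq (mul_div_assoc _ _ _)
  obtain ⟨ρ, hρ1, hρr⟩ := exists_between hr
  obtain ⟨η, hη0, hη⟩ := exists_between (lt_min hδ (zero_lt_one.trans hr))
  have hsum : ∀ i, HasSum (fun k : ℕ => ((k.factorial : ℂ)⁻¹) • iteratedDeriv k (g i) 0)
      (g i 1) := fun i => by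
    simpa using Complex.hasSum_taylorSeries_on_ball (hd i) (z := 1) (by simpa using hr)
  have hlim := tendsto_tsum_of_dominated_convergence (𝓕 := atTop)
    (f := fun i (k : ℕ) => ((k.factorial : ℂ)⁻¹) • iteratedDeriv k (g i) 0) (g := fun _ => (0 : F))
    (bound := fun k => M * (ρ⁻¹) ^ k)
    ((summable_geometric_of_lt_one (by positivity) (inv_lt_one_of_one_lt₀ hρ1)).mul_left M)
    (fun k => by
      refine squeeze_zero_norm (a := fun i => ε i / η ^ k) (fun i => ?_)
        (by simpa using hε0.div_const (η ^ k))
      refine cauchy i k hη0 (hη.trans_le (min_le_right _ _)) fun z hz => hε i z ?_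
      rw [mem_ball_zero_iff, mem_sphere_zero_iff_norm.1 hz]
      exact hη.trans_le (min_le_left _ _))
    (Eventually.of_forall fun i k => by
      rw [inv_pow, ← div_eq_mul_inv]
      refine cauchy i k (zero_lt_one.trans hρ1) hρr fun z hz => hM i z ?_
      rwa [mem_ball_zero_iff, mem_sphere_zero_iff_norm.1 hz])
  simpa [(hsum _).tsum_eq] using hlim

open Filter Topology Metric Set in
/-- If a holomorphic self-map `F` of a ball `{‖R x‖ < 1}` fixes `ker Q` pointwise and its derivative
at the origin strictly contracts `‖Q x‖`, then `F` strictly contracts `‖Q x‖` near the origin. -/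
theorem exists_contraction_near_zero {V W : Type*}
    [NormedAddCommGroup V] [NormedSpace ℂ V] [NormedAddCommGroup W] [NormedSpace ℂ W]
    {U : Set V} (hU : U ∈ 𝓝 0) {F : V → V} (hd : DifferentiableOn ℂ F U) (hF0 : F 0 = 0)
    {F' : V →L[ℂ] V} (hF' : HasFDerivAt F F' 0)
    (Q : V →L[ℂ] W) (J : W →L[ℂ] V) (hQJ : ∀ x, Q (J (Q x)) = Q x)
    (hfix : ∀ x ∈ U, Q x = 0 → F x = x) {c : ℝ} (hc0 : 0 ≤ c) (hc : c < 1)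
    (hcontr : ∀ x, ‖Q (F' x)‖ ≤ c * ‖Q x‖) :
    ∃ c' < 1, 0 ≤ c' ∧ ∃ ρ > 0, ∀ z, ‖z‖ < ρ → ‖Q (F z)‖ ≤ c' * ‖Q z‖ := by
  obtain ⟨c', hcc', hc'⟩ := exists_between hc
  refine ⟨c', hc', hc0.trans hcc'.le, ?_⟩
  set K : ℝ := 1 + ‖J‖ * ‖Q‖ + ‖J‖ with hK
  have hK0 : 0 < K := by positivity
  set e : ℝ := (c' - c) / ((1 + ‖Q‖) * K) with he
  have he0 : 0 < e := div_pos (sub_pos.2 hcc') (by positivity)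
  have hlit := hF'.isLittleO.def he0
  obtain ⟨s, hs0, hs⟩ := Metric.eventually_nhds_iff.1 (hlit.and hU)
  simp only [dist_zero_right, hF0, sub_zero] at hs
  set τ : ℝ := s / K with hτ
  have hτ0 : 0 < τ := div_pos hs0 hK0
  refine ⟨min τ (τ / (1 + ‖Q‖)), by positivity, fun z hz => ?_⟩
  have hz1 : ‖z‖ < τ := hz.trans_le (min_le_left _ _)
  have hz2 : ‖Q z‖ < τ := by
    have h1 : ‖z‖ * (1 + ‖Q‖) < τ := (lt_div_iff₀ (by positivity)).1 (hz.trans_le (min_le_right _ _))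
    have h2 := Q.le_opNorm z
    nlinarith [norm_nonneg z]
  have hKτ : K * τ = s := by rw [hτ]; field_simp
  rcases eq_or_ne (Q z) 0 with hq | hq
  · rw [hfix z (hs (hz1.trans_le ?_)).2 hq, hq]
    · simp
    · rw [← hKτ]
      refine le_mul_of_one_le_left hτ0.le ?_
      have : 0 ≤ ‖J‖ * ‖Q‖ + ‖J‖ := by positivity
      linarith
  have hq0 : 0 < ‖Q z‖ := norm_pos_iff.2 hq
  set z' := z - J (Q z) with hz'
  set u := ((‖Q z‖⁻¹ : ℝ) : ℂ) • J (Q z) with hu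
  have hQz' : Q z' = 0 := by simp [hz', hQJ]
  have hQu : ‖Q u‖ = 1 := by
    rw [hu, map_smul, hQJ, norm_smul]
    simp [hq0.ne']
  have hun : ‖u‖ ≤ ‖J‖ := by
    rw [hu, norm_smul]
    have := J.le_opNorm (Q z)
    simp only [Complex.ofReal_inv, norm_inv, Complex.norm_real, norm_norm]
    rw [inv_mul_le_iff₀ hq0]
    linarith
  have hz'n : ‖z'‖ ≤ (1 + ‖J‖ * ‖Q‖) * τ := by
    have h1 := J.le_opNorm (Q z)
    have h2 := Q.le_opNorm z
    have h3 := norm_sub_le z (J (Q z))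
    have h4 : ‖J‖ * ‖Q z‖ ≤ ‖J‖ * (‖Q‖ * ‖z‖) := by gcongr
    have h5 : ‖J‖ * ‖Q‖ * ‖z‖ ≤ ‖J‖ * ‖Q‖ * τ := by gcongr
    rw [← hz'] at h3
    linarith
  have hin : ∀ σ ∈ ball (0 : ℂ) τ, ‖z' + σ • u‖ < s := fun σ hσ => by
    rw [mem_ball_zero_iff] at hσ
    have h1 := norm_add_le z' (σ • u)
    rw [norm_smul] at h1
    rcases (norm_nonneg J).eq_or_lt with hJ | hJ
    · exfalso
      have : u = 0 := norm_le_zero_iff.1 (by rw [hJ]; exact hun)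
      rw [this] at hQu
      simp at hQu
    have h2 : ‖σ‖ * ‖u‖ ≤ ‖σ‖ * ‖J‖ := by gcongr
    have h3 : ‖σ‖ * ‖J‖ < τ * ‖J‖ := by gcongr
    rw [← hKτ, hK]
    nlinarith
  have hz'U : z' ∈ U := by
    have h : z' + (0 : ℂ) • u ∈ U := (hs (hin 0 (mem_ball_self hτ0))).2
    rwa [zero_smul, add_zero] at h
  have hψ0 : Q (F (z' + (0 : ℂ) • u)) = 0 := by simp [hfix z' hz'U hQz', hQz']
  have hψd : DifferentiableOn ℂ (fun σ : ℂ => Q (F (z' + σ • u))) (ball 0 τ) :=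
    Q.differentiable.comp_differentiableOn <| hd.comp (by fun_prop) fun σ hσ => (hs (hin σ hσ)).2
  have hmaps : MapsTo (fun σ : ℂ => Q (F (z' + σ • u))) (ball 0 τ)
      (closedBall ((fun σ : ℂ => Q (F (z' + σ • u))) 0) (c' * τ)) := fun σ hσ => by
    simp only [hψ0, mem_closedBall_zero_iff]
    have h1 := (hs (hin σ hσ)).1
    have h2 := hcontr (z' + σ • u)
    have h3 : ‖Q (z' + σ • u)‖ = ‖σ‖ := by simp [hQz', norm_smul, hQu]
    have h4 := Q.le_opNorm (F (z' + σ • u) - F' (z' + σ • u))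
    have hσ' : ‖σ‖ < τ := mem_ball_zero_iff.1 hσ
    have h5 : ‖Q (F (z' + σ • u))‖ ≤ ‖Q (F' (z' + σ • u))‖ +
        ‖Q (F (z' + σ • u) - F' (z' + σ • u))‖ := by
      rw [map_sub]
      exact norm_le_norm_add_norm_sub' _ _
    have h6 : ‖Q‖ * ‖F (z' + σ • u) - F' (z' + σ • u)‖ ≤ (1 + ‖Q‖) * (e * s) := by
      have := (hin σ hσ).le
      gcongr
      · linarith
      · exact h1.trans (by gcongr)
    have h7 : (1 + ‖Q‖) * (e * s) = (c' - c) * τ := by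
      rw [he, ← hKτ]
      field_simp
    rw [h3] at h2
    have h8 : c * ‖σ‖ ≤ c * τ := by gcongr
    linarith
  have hmem : ((‖Q z‖ : ℝ) : ℂ) ∈ ball (0 : ℂ) τ := by simpa using hz2
  have key := Complex.dist_le_div_mul_dist_of_mapsTo_ball hψd hmaps hmem
  have hzu : z' + ((‖Q z‖ : ℝ) : ℂ) • u = z := by
    rw [hu, smul_smul, hz']
    have : ((‖Q z‖ : ℝ) : ℂ) ≠ 0 := by exact_mod_cast hq0.ne'
    simp [mul_inv_cancel₀ this]
  simp only [hψ0] at key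
  rw [hzu, mul_div_cancel_right₀ _ hτ0.ne'] at key
  simpa using key

open Filter Topology Metric Set in
/-- A holomorphic self-map `f` of a ball `{‖R x‖ < 1}` which fixes `ker Q` pointwise and whose
derivative `L` at the origin is such that `(1 + L) / 2` strictly contracts `‖Q x‖` has all its
fixed points in `ker Q`. -/
theorem eq_zero_of_fixed_of_contraction {V W Y : Type*}
    [NormedAddCommGroup V] [NormedSpace ℂ V] [NormedAddCommGroup W] [NormedSpace ℂ W]
    [CompleteSpace W] [NormedAddCommGroup Y] [NormedSpace ℂ Y]
    (R : V →L[ℂ] Y) {C : ℝ} (hR : ∀ x, ‖x‖ ≤ C * ‖R x‖) {f : V → V}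
    (hd : DifferentiableOn ℂ f {x | ‖R x‖ < 1}) (hmaps : MapsTo f {x | ‖R x‖ < 1} {x | ‖R x‖ < 1})
    (hf0 : f 0 = 0) (Q : V →L[ℂ] W) (J : W →L[ℂ] V) (hQJ : ∀ x, Q (J (Q x)) = Q x)
    (hfix : ∀ x, ‖R x‖ < 1 → Q x = 0 → f x = x) {c : ℝ} (hc0 : 0 ≤ c) (hc : c < 1)
    (hcontr : ∀ x, ‖Q ((2⁻¹ : ℂ) • (x + fderiv ℂ f 0 x))‖ ≤ c * ‖Q x‖)
    {x : V} (hx : ‖R x‖ < 1) (hfx : f x = x) : Q x = 0 := by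
  set U : Set V := {x | ‖R x‖ < 1} with hUdef
  have hUo : IsOpen U := isOpen_lt (by fun_prop) continuous_const
  have hU : U ∈ 𝓝 0 := hUo.mem_nhds (by simp [hUdef])
  set F : V → V := fun y => (2⁻¹ : ℂ) • (y + f y) with hF
  have hFd : DifferentiableOn ℂ F U := (differentiableOn_id.add hd).const_smul _
  have hFmaps : MapsTo F U U := fun y hy => by
    have h1 : ‖R (f y)‖ < 1 := hmaps hy
    have h2 : ‖R y‖ < 1 := hy
    have h3 := norm_add_le (R y) (R (f y))
    have h4 : ‖R (F y)‖ = 2⁻¹ * ‖R y + R (f y)‖ := by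
      simp only [hF, map_smul, map_add, norm_smul]
      simp
    change ‖R (F y)‖ < 1
    rw [h4]
    linarith
  have hF0 : F 0 = 0 := by simp [hF, hf0]
  have hFx : F x = x := by
    simp only [hF, hfx]
    rw [← two_smul ℂ x, smul_smul]
    simp
  have hFfix : ∀ y ∈ U, Q y = 0 → F y = y := fun y hy hq => by
    simp only [hF, hfix y hy hq]
    rw [← two_smul ℂ y, smul_smul]
    simp
  have hF' : HasFDerivAt F ((2⁻¹ : ℂ) • (ContinuousLinearMap.id ℂ V + fderiv ℂ f 0)) 0 :=
    ((hasFDerivAt_id 0).add (hd.differentiableAt hU).hasFDerivAt).const_smul _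
  obtain ⟨c', hc'1, hc'0, ρ, hρ, hloc⟩ := exists_contraction_near_zero hU hFd hF0 hF' Q J hQJ hFfix
    hc0 hc hcontr
  have hitmaps : ∀ i, MapsTo F^[i] U U := fun i => hFmaps.iterate i
  have hitd : ∀ i, DifferentiableOn ℂ F^[i] U := fun i => by
    induction i with
    | zero => exact differentiableOn_id
    | succ i ih =>
      rw [Function.iterate_succ']
      exact hFd.comp ih (hitmaps i)
  have hit0 : ∀ i, F^[i] 0 = 0 := fun i => Function.iterate_fixed hF0 i
  have hC : 0 ≤ C ∨ ∀ y : V, y = 0 := by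
    by_cases h : 0 ≤ C
    · exact Or.inl h
    · refine Or.inr fun y => norm_le_zero_iff.1 ((hR y).trans ?_)
      exact mul_nonpos_of_nonpos_of_nonneg (not_le.1 h).le (norm_nonneg _)
  rcases hC with hC | hV
  swap
  · rw [hV x, map_zero]
  obtain ⟨r, hr1, hrx⟩ : ∃ r : ℝ, 1 < r ∧ r * ‖R x‖ < 1 := by
    rcases (norm_nonneg (R x)).eq_or_lt with h | h
    · exact ⟨2, by norm_num, by rw [← h]; norm_num⟩
    · obtain ⟨r, h1, h2⟩ := exists_between ((one_lt_inv₀ h).2 hx)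
      exact ⟨r, h1, by rwa [lt_inv_comm₀ (by linarith) h, ← one_div, lt_div_iff₀ (by linarith),
        mul_comm] at h2⟩
  have htU : ∀ t ∈ ball (0 : ℂ) r, t • x ∈ U := fun t ht => by
    rw [mem_ball_zero_iff] at ht
    change ‖R (t • x)‖ < 1
    rw [map_smul, norm_smul]
    exact (by gcongr : ‖t‖ * ‖R x‖ ≤ r * ‖R x‖).trans_lt hrx
  have hcurve : ∀ i, DifferentiableOn ℂ (fun t : ℂ => F^[i] (t • x)) (ball 0 r) := fun i =>
    (hitd i).comp (by fun_prop) htU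
  have hnorm : ∀ i, ∀ y ∈ U, ‖F^[i] y‖ ≤ C := fun i y hy => by
    have h1 : ‖R (F^[i] y)‖ < 1 := hitmaps i hy
    exact (hR _).trans (mul_le_of_le_one_right hC h1.le)
  have hschwarz : ∀ i, ∀ t ∈ ball (0 : ℂ) r, ‖F^[i] (t • x)‖ ≤ C * ‖t‖ := fun i t ht => by
    have h := Complex.dist_le_div_mul_dist_of_mapsTo_ball (R₂ := C) (hcurve i) (fun s hs => by
      simpa [hit0] using hnorm i _ (htU s hs)) ht
    simp only [zero_smul, hit0, dist_zero_right] at h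
    exact h.trans (by gcongr; exact div_le_self hC hr1.le)
  have hδ : 0 < min 1 (ρ / (C + 1)) := by positivity
  have hsmall : ∀ i, ∀ t ∈ ball (0 : ℂ) (min 1 (ρ / (C + 1))),
      ‖Q (F^[i] (t • x))‖ ≤ c' ^ i * (‖Q‖ * C) := fun i t ht => by
    rw [mem_ball_zero_iff, lt_min_iff] at ht
    have htr : t ∈ ball (0 : ℂ) r := by
      rw [mem_ball_zero_iff]
      exact ht.1.trans hr1
    induction i with
    | zero =>
      have h := (Q.le_opNorm (t • x)).trans
        (mul_le_mul_of_nonneg_left (hnorm 0 _ (htU t htr)) (norm_nonneg _))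
      simpa using h
    | succ i ih =>
      rw [Function.iterate_succ_apply']
      refine (hloc _ ?_).trans ?_
      · have h1 := (lt_div_iff₀ (by linarith : (0 : ℝ) < C + 1)).1 ht.2
        have h2 := hschwarz i t htr
        nlinarith [norm_nonneg t]
      · rw [pow_succ', mul_assoc]
        gcongr
  have hlim := tendsto_zero_of_tendsto_zero_near_center (M := ‖Q‖ * C)
    (g := fun i t => Q (F^[i] (t • x))) hr1 hδ
    (fun i => Q.differentiable.comp_differentiableOn (hcurve i))
    (fun i t ht => (Q.le_opNorm _).trans
      (mul_le_mul_of_nonneg_left (hnorm i _ (htU t ht)) (norm_nonneg _))) hsmall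
    (by simpa using (tendsto_pow_atTop_nhds_zero_of_lt_one hc'0 hc'1).mul_const (‖Q‖ * C))
  have hconst : ∀ i, F^[i] x = x := fun i => Function.iterate_fixed hFx i
  simp only [one_smul, hconst] at hlim
  exact tendsto_nhds_unique tendsto_const_nhds hlim

/-- The row operator `b ↦ (b X₁, …, b X_d)` of a tuple of matrices. -/
noncomputable def rowOp (d n : ℕ) : MatTuple d n →L[ℂ]
    (EuclideanSpace ℂ (Fin n) →L[ℂ] EuclideanSpace ℂ (Fin d × Fin n)) :=
  LinearMap.toContinuousLinearMap
    { toFun := fun X => LinearMap.toContinuousLinearMap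
        (Matrix.toEuclideanLin (Matrix.of fun (i : Fin d × Fin n) p => X i.1 p i.2))
      map_add' := fun X Y => by
        ext b i
        simp [Matrix.toLpLin_apply, Matrix.mulVec, dotProduct, add_mul,
          Finset.sum_add_distrib]
      map_smul' := fun c X => by
        ext b i
        simp [Matrix.toLpLin_apply, Matrix.mulVec, dotProduct, Finset.mul_sum, mul_assoc] }

theorem rowOp_apply {d n : ℕ} (X : MatTuple d n) (b : EuclideanSpace ℂ (Fin n))
    (i : Fin d × Fin n) : rowOp d n X b i = ∑ p, X i.1 p i.2 * b p := by
  simp [rowOp, Matrix.toLpLin_apply, Matrix.mulVec, dotProduct]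

theorem rowOp_injective (d n : ℕ) : Function.Injective (rowOp d n) := by
  intro X Y h
  ext j p q
  have := congrArg (fun T => T (EuclideanSpace.single p 1) (j, q)) h
  simpa [rowOp_apply] using this

theorem norm_rowOp_sq {d n : ℕ} (X : MatTuple d n) (a : Fin n → ℂ) :
    ((‖rowOp d n X (WithLp.toLp 2 (star a))‖ ^ 2 : ℝ) : ℂ) =
      star a ⬝ᵥ ((∑ j, X j * (X j)ᴴ) *ᵥ a) := by
  rw [EuclideanSpace.norm_sq_eq, Matrix.sum_mulVec, dotProduct_sum, Fintype.sum_prod_type,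
    Complex.ofReal_sum]
  refine Finset.sum_congr rfl fun j _ => ?_
  have h : star a ⬝ᵥ ((X j * (X j)ᴴ) *ᵥ a) = star ((X j)ᴴ *ᵥ a) ⬝ᵥ ((X j)ᴴ *ᵥ a) := by
    rw [← Matrix.mulVec_mulVec, Matrix.star_mulVec, conjTranspose_conjTranspose,
      ← Matrix.dotProduct_mulVec]
  rw [h, Complex.ofReal_sum]
  refine Finset.sum_congr rfl fun q _ => ?_
  rw [rowOp_apply]
  have h2 : ∑ p, X j p q * (WithLp.toLp 2 (star a) : EuclideanSpace ℂ (Fin n)) p =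
      star (((X j)ᴴ *ᵥ a) q) := by
    simp [Matrix.mulVec, dotProduct]
  rw [h2, Pi.star_apply, norm_star]
  simp [← Complex.conj_mul']

theorem norm_sq_toLp_star {n : ℕ} (a : Fin n → ℂ) :
    ((‖(WithLp.toLp 2 (star a) : EuclideanSpace ℂ (Fin n))‖ ^ 2 : ℝ) : ℂ) = star a ⬝ᵥ a := by
  rw [EuclideanSpace.norm_sq_eq, Complex.ofReal_sum]
  refine Finset.sum_congr rfl fun q _ => ?_
  simp [← Complex.conj_mul']

theorem mem_freeBall_iff_forall {d n : ℕ} {X : MatTuple d n} :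
    X ∈ freeBall d n ↔ ∀ b ≠ 0, ‖rowOp d n X b‖ < ‖b‖ := by
  have key : ∀ a : Fin n → ℂ, 0 < star a ⬝ᵥ ((1 - ∑ j, X j * (X j)ᴴ) *ᵥ a) ↔
      ‖rowOp d n X (WithLp.toLp 2 (star a))‖ <
        ‖(WithLp.toLp 2 (star a) : EuclideanSpace ℂ (Fin n))‖ := fun a => by
    rw [Matrix.sub_mulVec, dotProduct_sub, Matrix.one_mulVec, ← norm_rowOp_sq, ← norm_sq_toLp_star,
      ← Complex.ofReal_sub, Complex.zero_lt_real, sub_pos,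
      sq_lt_sq₀ (norm_nonneg _) (norm_nonneg _)]
  have herm : (1 - ∑ j, X j * (X j)ᴴ).IsHermitian := by
    refine Matrix.isHermitian_one.sub ?_
    simp [Matrix.IsHermitian, Matrix.conjTranspose_sum]
  simp only [freeBall, Set.mem_ofPred_eq, Matrix.posDef_iff_dotProduct_mulVec, herm, true_and, key]
  refine ⟨fun h b hb => ?_, fun h a ha => h _ ?_⟩
  · have := @h (star b.ofLp) (by simpa using hb)
    simpa using this
  · simpa using ha

theorem mem_freeBall_iff {d n : ℕ} {X : MatTuple d n} :
    X ∈ freeBall d n ↔ ‖rowOp d n X‖ < 1 := by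
  rw [mem_freeBall_iff_forall]
  refine ⟨fun h => ?_, fun h b hb => ?_⟩
  · rcases subsingleton_or_nontrivial (EuclideanSpace ℂ (Fin n)) with hs | hs
    · simp [show rowOp d n X = 0 from by ext b; simp [Subsingleton.elim b 0]]
    · obtain ⟨b, hb, hmax⟩ := (isCompact_sphere (0 : EuclideanSpace ℂ (Fin n)) 1).exists_isMaxOn
        (NormedSpace.sphere_nonempty.2 zero_le_one)
        (f := fun b => ‖rowOp d n X b‖) (by fun_prop)
      have hb1 : ‖b‖ = 1 := mem_sphere_zero_iff_norm.1 hb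
      refine lt_of_le_of_lt (ContinuousLinearMap.opNorm_le_bound _ (norm_nonneg (rowOp d n X b))
        fun z => ?_) ((h b (norm_ne_zero_iff.1 (by simp [hb1]))).trans_eq hb1)
      rcases eq_or_ne z 0 with rfl | hz
      · simp
      have hz0 : 0 < ‖z‖ := norm_pos_iff.2 hz
      have := hmax (show ((‖z‖⁻¹ : ℝ) : ℂ) • z ∈ Metric.sphere 0 1 by
        simp [norm_smul, hz0.ne'])
      simp only [Set.mem_ofPred_eq, map_smul, norm_smul, Complex.norm_real, norm_inv, norm_norm]
        at this
      rwa [inv_mul_le_iff₀ hz0, mul_comm] at this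
  · have hb0 : 0 < ‖b‖ := norm_pos_iff.2 hb
    exact ((rowOp d n X).le_opNorm b).trans_lt (by nlinarith)

theorem freeBall_eq (d n : ℕ) : freeBall d n = {X | ‖rowOp d n X‖ < 1} :=
  Set.ext fun _ => mem_freeBall_iff

theorem smul_mem_freeBall_s14 {d n : ℕ} {X : MatTuple d n} (hX : X ∈ freeBall d n) {t : ℂ}
    (ht : ‖t‖ ≤ 1) : t • X ∈ freeBall d n := by
  rw [mem_freeBall_iff] at *
  rw [map_smul, norm_smul]
  exact (mul_le_of_le_one_left (norm_nonneg _) ht).trans_lt hX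

theorem exists_norm_le_rowOp (d n : ℕ) : ∃ C, ∀ X, ‖X‖ ≤ C * ‖rowOp d n X‖ := by
  obtain ⟨C, -, hC⟩ := (rowOp d n).toLinearMap.exists_antilipschitzWith
    (LinearMap.ker_eq_bot.2 (rowOp_injective d n))
  exact ⟨C, fun X => by simpa using hC.le_mul_dist X 0⟩

theorem conj_mem_freeBall {d n : ℕ} {X : MatTuple d n} (hX : X ∈ freeBall d n)
    {V : Matrix (Fin n) (Fin n) ℂ} (hV : V * Vᴴ = 1) :
    (fun j => Vᴴ * X j * V) ∈ freeBall d n := by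
  have hV' : Vᴴ * V = 1 := mul_eq_one_comm.1 hV
  have h := Matrix.PosDef.conjTranspose_mul_mul_same (A := 1 - ∑ j, X j * (X j)ᴴ) hX
    (Matrix.mulVec_injective_of_isUnit (IsUnit.of_mul_eq_one_right _ hV'))
  have h2 : Vᴴ * (1 - ∑ j, X j * (X j)ᴴ) * V = 1 - ∑ j, (Vᴴ * X j * V) * (Vᴴ * X j * V)ᴴ := by
    rw [mul_sub, sub_mul, mul_one, hV', Finset.mul_sum, Finset.sum_mul]
    refine congrArg (1 - ·) (Finset.sum_congr rfl fun j _ => ?_)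
    simp only [conjTranspose_mul, conjTranspose_conjTranspose]
    calc Vᴴ * (X j * (X j)ᴴ) * V = Vᴴ * X j * 1 * (X j)ᴴ * V := by simp only [mul_one, mul_assoc]
      _ = _ := by rw [← hV]; simp only [mul_assoc]
  rw [h2] at h
  exact h

namespace NCSelfMap

variable {d : ℕ} (f : NCSelfMap d)

theorem app_conj {n : ℕ} {X : MatTuple d n} (hX : X ∈ freeBall d n)
    {V : Matrix (Fin n) (Fin n) ℂ} (hV : V * Vᴴ = 1) :
    f.app n (fun j => Vᴴ * X j * V) = fun j => Vᴴ * f.app n X j * V := by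
  have hinv : V⁻¹ = Vᴴ := Matrix.inv_eq_right_inv hV
  have h := f.map_sim X V hX (IsUnit.of_mul_eq_one _ hV)
    (by rw [hinv]; exact conj_mem_freeBall hX hV)
  rwa [hinv] at h

theorem diagonal_eq_dSum {n : ℕ} (v : Fin (n + 1) → MatTuple d 1) :
    (fun j => diagonal fun i => v i j 0 0 : MatTuple d (n + 1)) =
      dSum (fun j => diagonal fun i => v i.castSucc j 0 0) (v (Fin.last n)) := by
  ext j p q
  refine Fin.addCases (fun p => ?_) (fun p => ?_) p <;>
  refine Fin.addCases (fun q => ?_) (fun q => ?_) q <;>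
  simp [dSum, Matrix.diagonal_apply, Fin.ext_iff, Subsingleton.elim _ (0 : Fin 1)]
  · rfl
  · intro h
    omega
  · intro h
    omega
  · rfl

theorem diagonal_mem_freeBall {n : ℕ} {v : Fin n → MatTuple d 1}
    (hv : ∀ i, v i ∈ freeBall d 1) :
    (fun j => diagonal fun i => v i j 0 0 : MatTuple d n) ∈ freeBall d n := by
  have h : (1 - ∑ j, diagonal (fun i => v i j 0 0) * (diagonal fun i => v i j 0 0)ᴴ :
      Matrix (Fin n) (Fin n) ℂ) = diagonal fun i => (1 - ∑ j, v i j * (v i j)ᴴ) 0 0 := by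
    ext p q
    rcases eq_or_ne p q with rfl | hpq
    · simp [Matrix.sum_apply, Matrix.mul_apply]
    · simp [Matrix.sum_apply, hpq]
  change Matrix.PosDef _
  rw [h, Matrix.posDef_diagonal_iff]
  exact fun i => Matrix.PosDef.diag_pos (hv i)

theorem app_diagonal {n : ℕ} {v : Fin n → MatTuple d 1} (hv : ∀ i, v i ∈ freeBall d 1) :
    f.app n (fun j => diagonal fun i => v i j 0 0) =
      fun j => diagonal fun i => f.app 1 (v i) j 0 0 := by
  induction n with
  | zero => exact Subsingleton.elim _ _
  | succ n ih =>
    rw [diagonal_eq_dSum, f.map_dSum _ _ (diagonal_mem_freeBall fun i => hv _) (hv _),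
      ih fun i => hv _, ← diagonal_eq_dSum fun i => f.app 1 (v i)]

theorem differentiableAt_app {n : ℕ} {X : MatTuple d n} (hX : X ∈ freeBall d n) :
    DifferentiableAt ℂ (f.app n) X :=
  (f.holo n).differentiableAt ((isOpen_freeBall d n).mem_nhds hX)

/-- The matrix of the derivative at the origin of the first level of an nc self-map. -/
noncomputable def jacobian : Matrix (Fin d) (Fin d) ℂ :=
  Matrix.of fun j k => fderiv ℂ (f.app 1) 0 (Pi.single k 1) j 0 0

theorem fderiv_app_single {n : ℕ} (k : Fin d) {H : Matrix (Fin n) (Fin n) ℂ}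
    (hH : H.IsHermitian) (j : Fin d) :
    fderiv ℂ (f.app n) 0 (Pi.single k H) j = f.jacobian j k • H := by
  set U : Matrix (Fin n) (Fin n) ℂ := hH.eigenvectorUnitary.1 with hU
  set l : Fin n → ℂ := fun i => (hH.eigenvalues i : ℂ) with hl
  have hUU : Uᴴ * Uᴴᴴ = 1 := by
    rw [conjTranspose_conjTranspose]
    exact (Matrix.mem_unitaryGroup_iff').1 hH.eigenvectorUnitary.2
  have hspec : H = U * diagonal l * Uᴴ := by
    conv_lhs => rw [hH.spectral_theorem]
    rfl
  let v : ℂ → Fin n → MatTuple d 1 := fun t i => (t * l i) • Pi.single k 1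
  have hv : ∀ t, t • (Pi.single k H : MatTuple d n) =
      fun j => Uᴴᴴ * (diagonal fun i => v t i j 0 0) * Uᴴ := fun t => by
    ext1 j
    rw [conjTranspose_conjTranspose]
    rcases eq_or_ne j k with rfl | hjk
    · have : (fun i => v t i j 0 0) = t • l := by ext i; simp [v]
      rw [this, diagonal_smul, mul_smul_comm, smul_mul_assoc, ← hspec]
      simp
    · have : (fun i => v t i j 0 0) = 0 := by ext i; simp [v, hjk]
      simp [this, hjk]
  have hev : ∀ᶠ t in nhds (0 : ℂ), ∀ i, v t i ∈ freeBall d 1 := by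
    rw [Filter.eventually_all]
    intro i
    have hc : Continuous fun t => v t i := by fun_prop
    exact hc.continuousAt.eventually_mem ((isOpen_freeBall d 1).mem_nhds
      (by simpa [v] using zero_mem_freeBall d 1))
  let Λ : (Fin n → ℂ) →L[ℂ] Matrix (Fin n) (Fin n) ℂ := LinearMap.toContinuousLinearMap
    { toFun := fun w => U * diagonal w * Uᴴ
      map_add' := fun w w' => by
        rw [← add_mul, ← mul_add, diagonal_add]
        rfl
      map_smul' := fun c w => by simp [diagonal_smul] }
  have h1 : HasDerivAt (fun t : ℂ => f.app n (t • Pi.single k H) j)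
      (fderiv ℂ (f.app n) 0 (Pi.single k H) j) 0 := by
    have h := (f.differentiableAt_app (zero_mem_freeBall d n)).hasFDerivAt
    have hs : HasDerivAt (fun t : ℂ => t • (Pi.single k H : MatTuple d n)) (Pi.single k H) 0 :=
      ((hasDerivAt_id (0 : ℂ)).smul_const (Pi.single k H : MatTuple d n)).congr_deriv
        (one_smul _ _)
    exact hasDerivAt_pi.1 (HasFDerivAt.comp_hasDerivAt_of_eq 0 h hs (by simp)) j
  have h2 : HasDerivAt (fun t : ℂ => Λ fun i => f.app 1 (v t i) j 0 0)
      (Λ fun i => l i * f.jacobian j k) 0 := by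
    refine Λ.hasFDerivAt.comp_hasDerivAt 0 (hasDerivAt_pi.2 fun i => ?_)
    have h := (f.differentiableAt_app (zero_mem_freeBall d 1)).hasFDerivAt
    have hs : HasDerivAt (fun t : ℂ => v t i) (l i • Pi.single k 1) 0 :=
      (((hasDerivAt_id (0 : ℂ)).mul_const (l i)).smul_const
        (Pi.single k 1 : MatTuple d 1)).congr_deriv (by rw [one_mul])
    have h3 := hasDerivAt_pi.1 (hasDerivAt_pi.1 (hasDerivAt_pi.1
      (HasFDerivAt.comp_hasDerivAt_of_eq 0 h hs (by simp [v])) j) 0) 0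
    refine h3.congr_deriv ?_
    exact congrFun (congrFun (congrFun
      ((fderiv ℂ (f.app 1) 0).map_smul (l i) (Pi.single k 1)) j) 0) 0
  have heq : (fun t : ℂ => f.app n (t • Pi.single k H) j) =ᶠ[nhds 0]
      fun t : ℂ => Λ fun i => f.app 1 (v t i) j 0 0 := by
    filter_upwards [hev] with t ht
    rw [hv t, f.app_conj (diagonal_mem_freeBall ht) hUU, f.app_diagonal ht,
      conjTranspose_conjTranspose]
    rfl
  rw [h1.unique (h2.congr_of_eventuallyEq heq)]
  have : (fun i => l i * f.jacobian j k) = f.jacobian j k • l := by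
    ext i
    simp [mul_comm]
  rw [this, map_smul]
  congr 1
  exact hspec.symm

theorem fderiv_app {n : ℕ} (X : MatTuple d n) (j : Fin d) :
    fderiv ℂ (f.app n) 0 X j = ∑ k, f.jacobian j k • X k := by
  have h : ∀ k (A : Matrix (Fin n) (Fin n) ℂ),
      fderiv ℂ (f.app n) 0 (Pi.single k A) j = f.jacobian j k • A := fun k A => by
    have hA := realPart_add_I_smul_imaginaryPart A
    have hs : (Pi.single k A : MatTuple d n) =
        (Pi.single k (realPart A : Matrix (Fin n) (Fin n) ℂ) : MatTuple d n) +
        Complex.I • (Pi.single k (imaginaryPart A : Matrix (Fin n) (Fin n) ℂ) : MatTuple d n) := by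
      rw [← Pi.single_smul, ← Pi.single_add, hA]
    rw [hs, map_add, map_smul, Pi.add_apply, Pi.smul_apply,
      f.fderiv_app_single k (realPart A).2, f.fderiv_app_single k (imaginaryPart A).2,
      smul_comm, ← smul_add, hA]
  conv_lhs => rw [← Finset.univ_sum_single X]
  rw [map_sum, Finset.sum_apply]
  exact Finset.sum_congr rfl fun k _ => h k _

end NCSelfMap

theorem smul_mem_freeBall_of_norm_rowOp {d n : ℕ} {Y : MatTuple d n}
    (hY : ∀ b, ‖rowOp d n Y b‖ ≤ ‖b‖) {t : ℂ} (ht : ‖t‖ < 1) : t • Y ∈ freeBall d n := by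
  rw [mem_freeBall_iff, map_smul, norm_smul]
  have h : ‖rowOp d n Y‖ ≤ 1 :=
    ContinuousLinearMap.opNorm_le_bound _ zero_le_one fun b => by simpa using hY b
  exact (mul_le_of_le_one_right (norm_nonneg _) h).trans_lt ht

theorem norm_rowOp_of_coisometry {d n : ℕ} {Y : MatTuple d n}
    (hY : ∑ j, Y j * (Y j)ᴴ = 1) (b : EuclideanSpace ℂ (Fin n)) : ‖rowOp d n Y b‖ = ‖b‖ := by
  have h1 := norm_rowOp_sq Y (star b.ofLp)
  rw [hY, one_mulVec, ← norm_sq_toLp_star, Complex.ofReal_inj,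
    sq_eq_sq₀ (norm_nonneg _) (norm_nonneg _)] at h1
  simpa using h1

theorem norm_rowOp_scalarPt {d n : ℕ} (v : Fin d → ℂ) (b : EuclideanSpace ℂ (Fin n)) :
    ‖rowOp d n (scalarPt d n v) b‖ = ‖(WithLp.toLp 2 v : EuclideanSpace ℂ (Fin d))‖ * ‖b‖ := by
  rw [← sq_eq_sq₀ (norm_nonneg _) (by positivity), mul_pow, EuclideanSpace.norm_sq_eq,
    EuclideanSpace.norm_sq_eq, EuclideanSpace.norm_sq_eq, Fintype.sum_prod_type,
    Finset.sum_mul_sum]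
  refine Finset.sum_congr rfl fun j _ => Finset.sum_congr rfl fun q _ => ?_
  rw [rowOp_apply]
  simp [scalarPt, Matrix.one_apply, mul_pow]

namespace NCSelfMap

variable {d : ℕ} (f : NCSelfMap d)

theorem differentiableOn_slice {n : ℕ} {Y : MatTuple d n} (hY : ∀ b, ‖rowOp d n Y b‖ ≤ ‖b‖)
    (b : EuclideanSpace ℂ (Fin n)) :
    DifferentiableOn ℂ (fun t : ℂ => rowOp d n (f.app n (t • Y)) b) (Metric.ball 0 1) := by
  intro t ht
  have h := f.differentiableAt_app
    (smul_mem_freeBall_of_norm_rowOp hY (mem_ball_zero_iff.1 ht))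
  have h2 : DifferentiableAt ℂ (fun t : ℂ => f.app n (t • Y)) t :=
    DifferentiableAt.comp t h (by fun_prop)
  exact (((rowOp d n).differentiableAt.comp t h2).clm_apply
    (differentiableAt_const b)).differentiableWithinAt

theorem mapsTo_slice {n : ℕ} (h0 : f.app n 0 = 0) {Y : MatTuple d n}
    (hY : ∀ b, ‖rowOp d n Y b‖ ≤ ‖b‖) (b : EuclideanSpace ℂ (Fin n)) :
    Set.MapsTo (fun t : ℂ => rowOp d n (f.app n (t • Y)) b) (Metric.ball 0 1)
      (Metric.closedBall (rowOp d n (f.app n ((0 : ℂ) • Y)) b) ‖b‖) := by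
  intro t ht
  have h := f.mapsTo n (smul_mem_freeBall_of_norm_rowOp hY (mem_ball_zero_iff.1 ht))
  rw [mem_freeBall_iff] at h
  simp only [zero_smul, h0, map_zero, _root_.zero_apply, mem_closedBall_zero_iff]
  exact ((rowOp d n _).le_opNorm b).trans (mul_le_of_le_one_left (norm_nonneg _) h.le)

theorem deriv_slice {n : ℕ} (Y : MatTuple d n) (b : EuclideanSpace ℂ (Fin n)) :
    deriv (fun t : ℂ => rowOp d n (f.app n (t • Y)) b) 0 =
      rowOp d n (fderiv ℂ (f.app n) 0 Y) b := by
  have h := (f.differentiableAt_app (zero_mem_freeBall d n)).hasFDerivAt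
  have hs : HasDerivAt (fun t : ℂ => t • Y) Y 0 :=
    ((hasDerivAt_id (0 : ℂ)).smul_const Y).congr_deriv (one_smul _ _)
  have h2 : HasDerivAt (fun t : ℂ => f.app n (t • Y)) (fderiv ℂ (f.app n) 0 Y) 0 :=
    HasFDerivAt.comp_hasDerivAt_of_eq 0 h hs (by simp)
  have h3 := ((rowOp d n).hasFDerivAt.comp_hasDerivAt 0 h2).clm_apply (hasDerivAt_const 0 b)
  refine h3.deriv.trans ?_
  rw [map_zero]
  exact add_zero _

theorem norm_rowOp_fderiv_le {n : ℕ} (h0 : f.app n 0 = 0) {Y : MatTuple d n}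
    (hY : ∀ b, ‖rowOp d n Y b‖ ≤ ‖b‖) (b : EuclideanSpace ℂ (Fin n)) :
    ‖rowOp d n (fderiv ℂ (f.app n) 0 Y) b‖ ≤ ‖b‖ := by
  have h := Complex.norm_deriv_le_div_of_mapsTo_ball (f.differentiableOn_slice hY b)
    (f.mapsTo_slice h0 hY b) one_pos
  rwa [deriv_slice, div_one] at h

theorem app_smul_of_fderiv_eq {n : ℕ} (h0 : f.app n 0 = 0) {Y : MatTuple d n}
    (hY : ∀ b, ‖rowOp d n Y b‖ = ‖b‖) (hfd : fderiv ℂ (f.app n) 0 Y = Y) {t : ℂ}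
    (ht : ‖t‖ < 1) : f.app n (t • Y) = t • Y := by
  apply rowOp_injective d n
  ext1 b
  have hds : dslope (fun t : ℂ => rowOp d n (f.app n (t • Y)) b) 0 0 = rowOp d n Y b := by
    rw [dslope_same, deriv_slice, hfd]
  have h := Complex.affine_of_mapsTo_ball_of_norm_dslope_eq_div
    (f.differentiableOn_slice (fun b => (hY b).le) b)
    (f.mapsTo_slice h0 (fun b => (hY b).le) b) (Metric.mem_ball_self one_pos)
    (by rw [hds, hY, div_one]) (mem_ball_zero_iff.2 ht)
  simp only [hds] at h
  rw [h]
  simp [h0]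

theorem app_zero_s14 (h0 : f.app 1 0 = 0) (n : ℕ) : f.app n 0 = 0 := by
  have h := f.app_diagonal (n := n) (v := fun _ => 0) fun _ => zero_mem_freeBall d 1
  have hz : (fun j => diagonal fun i => (0 : MatTuple d 1) j 0 0 : MatTuple d n) = 0 := by
    ext j p q
    simp [diagonal_apply]
  simp only [h0] at h
  rwa [hz] at h

theorem fderiv_app_scalarPt (v : Fin d → ℂ) :
    fderiv ℂ (f.app 1) 0 (scalarPt d 1 v) = scalarPt d 1 (f.jacobian *ᵥ v) := by
  ext1 j
  rw [fderiv_app]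
  simp [scalarPt, mulVec, dotProduct, Finset.sum_smul, smul_smul]

theorem norm_jacobian_mulVec_le (h0 : f.app 1 0 = 0) (v : Fin d → ℂ) :
    ‖(WithLp.toLp 2 (f.jacobian *ᵥ v) : EuclideanSpace ℂ (Fin d))‖ ≤
      ‖(WithLp.toLp 2 v : EuclideanSpace ℂ (Fin d))‖ := by
  have hle : ‖toEuclideanCLM (n := Fin d) (𝕜 := ℂ) f.jacobian‖ ≤ 1 := by
    refine ContinuousLinearMap.opNorm_le_of_unit_norm zero_le_one fun u hu => ?_
    have h := f.norm_rowOp_fderiv_le h0 (Y := scalarPt d 1 u.ofLp)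
      (fun b => by simp [norm_rowOp_scalarPt, hu]) (EuclideanSpace.single 0 1)
    rw [← WithLp.toLp_ofLp 2 u, toEuclideanCLM_toLp]
    simpa [fderiv_app_scalarPt, norm_rowOp_scalarPt] using h
  have h2 := (toEuclideanCLM (n := Fin d) (𝕜 := ℂ) f.jacobian).le_of_opNorm_le hle
    (WithLp.toLp 2 v)
  simpa using h2

theorem jacobian_apply_of_fixed {m : ℕ}
    (hfix : ∀ v ∈ freeBall d 1, (∀ j : Fin d, m ≤ (j : ℕ) → v j = 0) → f.app 1 v = v)
    (j : Fin d) {k : Fin d} (hk : (k : ℕ) < m) : f.jacobian j k = (1 : Matrix _ _ ℂ) j k := by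
  have h := (f.differentiableAt_app (zero_mem_freeBall d 1)).hasFDerivAt
  have hs : HasDerivAt (fun t : ℂ => t • (Pi.single k 1 : MatTuple d 1)) (Pi.single k 1) 0 :=
    ((hasDerivAt_id (0 : ℂ)).smul_const (Pi.single k 1 : MatTuple d 1)).congr_deriv
      (one_smul _ _)
  have h2 : HasDerivAt (fun t : ℂ => f.app 1 (t • (Pi.single k 1 : MatTuple d 1)))
      (fderiv ℂ (f.app 1) 0 (Pi.single k 1)) 0 :=
    HasFDerivAt.comp_hasDerivAt_of_eq 0 h hs (by simp)
  have hev : ∀ᶠ t in nhds (0 : ℂ), t • (Pi.single k 1 : MatTuple d 1) ∈ freeBall d 1 :=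
    hs.continuousAt.eventually_mem ((isOpen_freeBall d 1).mem_nhds
      (by simpa using zero_mem_freeBall d 1))
  have heq : (fun t : ℂ => f.app 1 (t • (Pi.single k 1 : MatTuple d 1))) =ᶠ[nhds 0]
      fun t => t • (Pi.single k 1 : MatTuple d 1) := by
    filter_upwards [hev] with t ht
    refine hfix _ ht fun i hi => ?_
    have : i ≠ k := by
      rintro rfl
      omega
    simp [this]
  have h3 := h2.unique (hs.congr_of_eventuallyEq heq)
  have h4 := congrFun (congrFun (congrFun h3 j) 0) 0
  refine h4.trans ?_
  rcases eq_or_ne j k with rfl | hjk <;> simp [*]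

theorem fderiv_app_eq_self {m n : ℕ}
    (hfix : ∀ v ∈ freeBall d 1, (∀ j : Fin d, m ≤ (j : ℕ) → v j = 0) → f.app 1 v = v)
    {X : MatTuple d n} (hX : ∀ j : Fin d, m ≤ (j : ℕ) → X j = 0) :
    fderiv ℂ (f.app n) 0 X = X := by
  ext1 j
  rw [fderiv_app]
  have : ∀ k, f.jacobian j k • X k = (1 : Matrix (Fin d) (Fin d) ℂ) j k • X k := fun k => by
    rcases lt_or_ge (k : ℕ) m with hk | hk
    · rw [f.jacobian_apply_of_fixed hfix j hk]
    · simp [hX k hk]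
  simp [this, Matrix.one_apply]

theorem eq_zero_of_jacobian_mulVec_eq {m : ℕ}
    (hfix1 : ∀ v ∈ freeBall d 1, (f.app 1 v = v ↔ ∀ j : Fin d, m ≤ (j : ℕ) → v j = 0))
    {v : Fin d → ℂ} (hv : f.jacobian *ᵥ v = v) (j : Fin d) (hj : m ≤ (j : ℕ)) : v j = 0 := by
  rcases eq_or_ne v 0 with rfl | hv0
  · rfl
  have h0 : f.app 1 0 = 0 := (hfix1 0 (zero_mem_freeBall d 1)).2 fun _ _ => rfl
  set r : ℝ := ‖(WithLp.toLp 2 v : EuclideanSpace ℂ (Fin d))‖ with hr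
  have hr0 : r ≠ 0 := by simpa [hr] using hv0
  have hnorm : ∀ b, ‖rowOp d 1 (scalarPt d 1 ((r⁻¹ : ℂ) • v)) b‖ = ‖b‖ := fun b => by
    rw [norm_rowOp_scalarPt, WithLp.toLp_smul, norm_smul, ← hr]
    rw [norm_inv, Complex.norm_real, hr, norm_norm, ← hr, inv_mul_cancel₀ hr0, one_mul]
  have hfd : fderiv ℂ (f.app 1) 0 (scalarPt d 1 ((r⁻¹ : ℂ) • v)) =
      scalarPt d 1 ((r⁻¹ : ℂ) • v) := by
    rw [fderiv_app_scalarPt, mulVec_smul, hv]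
  have ht : ‖(2⁻¹ : ℂ)‖ < 1 := by norm_num
  have h := (hfix1 _ (smul_mem_freeBall_of_norm_rowOp (fun b => (hnorm b).le) ht)).1
    (f.app_smul_of_fderiv_eq h0 hnorm hfd ht) j hj
  have h2 := congrFun (congrFun h 0) 0
  simpa [scalarPt, hr0] using h2

/-- The midpoint of the identity and the derivative at the origin is a strict contraction modulo
the fixed coordinates. -/
theorem exists_contraction {m : ℕ}
    (hfix1 : ∀ v ∈ freeBall d 1, (f.app 1 v = v ↔ ∀ j : Fin d, m ≤ (j : ℕ) → v j = 0)) :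
    ∃ c : ℝ, 0 ≤ c ∧ c < 1 ∧ ∀ v : Fin d → ℂ, (∀ j : Fin d, (j : ℕ) < m → v j = 0) →
      ‖(WithLp.toLp 2 ((2⁻¹ : ℂ) • (v + f.jacobian *ᵥ v)) : EuclideanSpace ℂ (Fin d))‖ ≤
        c * ‖(WithLp.toLp 2 v : EuclideanSpace ℂ (Fin d))‖ := by
  have h0 : f.app 1 0 = 0 := (hfix1 0 (zero_mem_freeBall d 1)).2 fun _ _ => rfl
  set S : Set (EuclideanSpace ℂ (Fin d)) :=
    Metric.sphere 0 1 ∩ {u | ∀ j : Fin d, (j : ℕ) < m → u j = 0} with hS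
  set g : EuclideanSpace ℂ (Fin d) → ℝ := fun u =>
    ‖(WithLp.toLp 2 ((2⁻¹ : ℂ) • (u.ofLp + f.jacobian *ᵥ u.ofLp)) :
      EuclideanSpace ℂ (Fin d))‖ with hg
  have hgc : Continuous g := by
    have : Continuous fun u : EuclideanSpace ℂ (Fin d) =>
        (2⁻¹ : ℂ) • (u + toEuclideanCLM (n := Fin d) (𝕜 := ℂ) f.jacobian u) := by fun_prop
    exact this.norm
  have hSc : IsCompact S := by
    refine (isCompact_sphere _ _).inter_right ?_
    simp only [Set.ofPred_forall]
    refine isClosed_iInter fun j => isClosed_iInter fun _ => isClosed_eq ?_ continuous_const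
    fun_prop
  have hlt : ∀ u ∈ S, g u < 1 := by
    rintro u ⟨hu, hum⟩
    have hu1 : ‖u‖ = 1 := mem_sphere_zero_iff_norm.1 hu
    have hB : ‖(WithLp.toLp 2 (f.jacobian *ᵥ u.ofLp) : EuclideanSpace ℂ (Fin d))‖ ≤ 1 := by
      simpa [hu1] using f.norm_jacobian_mulVec_le h0 u.ofLp
    have hne : u ≠ WithLp.toLp 2 (f.jacobian *ᵥ u.ofLp) := by
      intro h
      have hz : u = 0 := by
        ext j
        rcases lt_or_ge (j : ℕ) m with hj | hj
        · exact hum j hj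
        · exact f.eq_zero_of_jacobian_mulVec_eq hfix1 (congrArg WithLp.ofLp h).symm j hj
      simp [hz] at hu1
    have h := norm_combo_lt_of_ne hu1.le hB hne (a := 2⁻¹) (b := 2⁻¹) (by norm_num)
      (by norm_num) (by norm_num)
    refine lt_of_eq_of_lt (congrArg norm ?_) h
    ext j
    simp [mul_add]
  obtain ⟨c, hc0, hc1, hc⟩ : ∃ c : ℝ, 0 ≤ c ∧ c < 1 ∧ ∀ u ∈ S, g u ≤ c := by
    rcases S.eq_empty_or_nonempty with hE | hN
    · exact ⟨0, le_rfl, one_pos, by simp [hE]⟩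
    · obtain ⟨u, hu, hmax⟩ := hSc.exists_isMaxOn hN hgc.continuousOn
      exact ⟨g u, norm_nonneg _, hlt u hu, fun w hw => hmax hw⟩
  refine ⟨c, hc0, hc1, fun v hv => ?_⟩
  set r : ℝ := ‖(WithLp.toLp 2 v : EuclideanSpace ℂ (Fin d))‖ with hr
  rcases eq_or_ne v 0 with rfl | hv0
  · simp [hr]
  have hr0 : 0 < r := norm_pos_iff.2 (by simpa using hv0)
  have h := hc (WithLp.toLp 2 ((r⁻¹ : ℂ) • v)) ⟨by
    rw [mem_sphere_zero_iff_norm, WithLp.toLp_smul, norm_smul, ← hr]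
    simp [abs_of_pos hr0, hr0.ne'], fun j hj => by simp [hv j hj]⟩
  simp only [hg] at h
  rw [mulVec_smul, ← smul_add, smul_comm, WithLp.toLp_smul, norm_smul] at h
  rwa [norm_inv, Complex.norm_real, Real.norm_of_nonneg hr0.le, inv_mul_le_iff₀ hr0,
    mul_comm] at h

end NCSelfMap

open scoped MatrixOrder Matrix.Norms.L2Operator in
theorem exists_eq_conjTranspose_mul_self {n : ℕ} {A : Matrix (Fin n) (Fin n) ℂ}
    (hA : A.PosSemidef) : ∃ D : Matrix (Fin n) (Fin n) ℂ, A = Dᴴ * D :=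
  CStarAlgebra.nonneg_iff_eq_star_mul_self.1 hA.nonneg

/-- The tuple of block upper triangular matrices with diagonal blocks `X j`, `W j` and corner
`P j`. -/
def upperBlock {d n : ℕ} (X P W : MatTuple d n) : MatTuple d (n + n) :=
  fun j => Matrix.reindex finSumFinEquiv finSumFinEquiv (Matrix.fromBlocks (X j) (P j) 0 (W j))

theorem upperBlock_zero {d n : ℕ} (X W : MatTuple d n) : upperBlock X 0 W = dSum X W := rfl

theorem upperBlock_coisometry {d n : ℕ} {X P W : MatTuple d n}
    (hXP : ∑ j, (X j * (X j)ᴴ + P j * (P j)ᴴ) = 1) (hPW : ∑ j, P j * (W j)ᴴ = 0)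
    (hW : ∑ j, W j * (W j)ᴴ = 1) : ∑ j, upperBlock X P W j * (upperBlock X P W j)ᴴ = 1 := by
  have hWP : ∑ j, W j * (P j)ᴴ = 0 := by
    simpa [conjTranspose_sum] using congrArg conjTranspose hPW
  have h : ∀ j, upperBlock X P W j * (upperBlock X P W j)ᴴ =
      Matrix.reindexLinearEquiv ℂ ℂ finSumFinEquiv finSumFinEquiv
        (Matrix.fromBlocks (X j * (X j)ᴴ + P j * (P j)ᴴ) (P j * (W j)ᴴ) (W j * (P j)ᴴ)
          (W j * (W j)ᴴ)) := fun j => by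
    simp [upperBlock, conjTranspose_submatrix, fromBlocks_conjTranspose,
      submatrix_mul_equiv, fromBlocks_multiply]
  have hsum : ∑ j, Matrix.fromBlocks (X j * (X j)ᴴ + P j * (P j)ᴴ) (P j * (W j)ᴴ)
      (W j * (P j)ᴴ) (W j * (W j)ᴴ) = 1 := by
    have hs : ∑ j, Matrix.fromBlocks (X j * (X j)ᴴ + P j * (P j)ᴴ) (P j * (W j)ᴴ)
        (W j * (P j)ᴴ) (W j * (W j)ᴴ) = Matrix.fromBlocks (∑ j, (X j * (X j)ᴴ + P j * (P j)ᴴ))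
          (∑ j, P j * (W j)ᴴ) (∑ j, W j * (P j)ᴴ) (∑ j, W j * (W j)ᴴ) := by
      ext (p | p) (q | q) <;> simp [Matrix.sum_apply]
    rw [hs, hXP, hPW, hWP, hW, fromBlocks_one]
  simp only [h, ← map_sum, hsum]
  simp

theorem norm_rowOp_upperBlock_le {d n : ℕ} {X P W : MatTuple d n}
    (hXP : ∑ j, (X j * (X j)ᴴ + P j * (P j)ᴴ) = 1) (hPW : ∑ j, P j * (W j)ᴴ = 0)
    (hW : ∑ j, W j * (W j)ᴴ = 1) {r : ℝ} (hr0 : 0 ≤ r) (hr1 : r ≤ 1)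
    (b : EuclideanSpace ℂ (Fin (n + n))) :
    ‖rowOp d (n + n) (upperBlock X ((r : ℂ) • P) W) b‖ ≤ ‖b‖ := by
  have h1 := norm_rowOp_of_coisometry (upperBlock_coisometry hXP hPW hW) b
  have h2 := norm_rowOp_of_coisometry (upperBlock_coisometry (P := -P) (by simpa using hXP)
    (by simpa using hPW) hW) b
  have h3 : upperBlock X ((r : ℂ) • P) W =
      (((1 + r) / 2 : ℝ) : ℂ) • upperBlock X P W +
        (((1 - r) / 2 : ℝ) : ℂ) • upperBlock X (-P) W := by
    ext j p q
    simp only [upperBlock, reindex_apply, submatrix_apply, Pi.add_apply, Pi.smul_apply,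
      Pi.neg_apply, Matrix.add_apply, Matrix.smul_apply]
    rcases finSumFinEquiv.symm p with p | p <;> rcases finSumFinEquiv.symm q with q | q <;>
    simp <;> ring
  rw [h3, map_add, map_smul, map_smul, _root_.add_apply, _root_.smul_apply, _root_.smul_apply]
  refine (norm_add_le _ _).trans ?_
  rw [norm_smul, norm_smul, h1, h2, Complex.norm_real, Complex.norm_real,
    Real.norm_of_nonneg (by linarith), Real.norm_of_nonneg (by linarith)]
  linarith

theorem upperBlock_similar {d n : ℕ} (X P W : MatTuple d n) {r : ℂ} (hr : r ≠ 0) :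
    ∃ S : Matrix (Fin (n + n)) (Fin (n + n)) ℂ, IsUnit S ∧
      ∀ j, S⁻¹ * upperBlock X P W j * S = upperBlock X (r • P) W j := by
  set e : Fin n ⊕ Fin n ≃ Fin (n + n) := finSumFinEquiv with he
  set S : Matrix (Fin (n + n)) (Fin (n + n)) ℂ := reindex e e (fromBlocks 1 0 0 (r • 1)) with hS
  set T : Matrix (Fin (n + n)) (Fin (n + n)) ℂ := reindex e e (fromBlocks 1 0 0 (r⁻¹ • 1)) with hT
  have hST : S * T = 1 := by
    simp [hS, hT, submatrix_mul_equiv, fromBlocks_multiply, hr]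
  refine ⟨S, IsUnit.of_mul_eq_one _ hST, fun j => ?_⟩
  rw [Matrix.inv_eq_right_inv hST]
  simp [hS, hT, upperBlock, submatrix_mul_equiv, fromBlocks_multiply, hr, ← he]

namespace NCSelfMap

variable {d : ℕ} (f : NCSelfMap d)

theorem app_smul_upperBlock {n : ℕ} {X P W : MatTuple d n} (h0 : f.app 1 0 = 0)
    (hXP : ∑ j, (X j * (X j)ᴴ + P j * (P j)ᴴ) = 1) (hPW : ∑ j, P j * (W j)ᴴ = 0)
    (hW : ∑ j, W j * (W j)ᴴ = 1)
    (hfd : fderiv ℂ (f.app (n + n)) 0 (upperBlock X P W) = upperBlock X P W)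
    {t : ℂ} (ht : ‖t‖ < 1) {r : ℝ} (hr0 : 0 < r) (hr1 : r ≤ 1) :
    f.app (n + n) (t • upperBlock X ((r : ℂ) • P) W) = t • upperBlock X ((r : ℂ) • P) W := by
  have hY := norm_rowOp_of_coisometry (upperBlock_coisometry hXP hPW hW)
  obtain ⟨S, hS, hSj⟩ := upperBlock_similar X P W (r := r) (by exact_mod_cast hr0.ne')
  have hsim : (fun j => S⁻¹ * (t • upperBlock X P W) j * S) =
      t • upperBlock X ((r : ℂ) • P) W := by
    ext1 j
    rw [Pi.smul_apply, mul_smul_comm, smul_mul_assoc, hSj, Pi.smul_apply]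
  have h := f.map_sim (t • upperBlock X P W) S
    (smul_mem_freeBall_of_norm_rowOp (fun b => (hY b).le) ht) hS
    (by rw [hsim]; exact smul_mem_freeBall_of_norm_rowOp
          (norm_rowOp_upperBlock_le hXP hPW hW hr0.le hr1) ht)
  rwa [f.app_smul_of_fderiv_eq (f.app_zero_s14 h0 _) hY hfd ht, hsim] at h

theorem app_eq_self_of_fixed {m n : ℕ} (hm2 : 2 ≤ m) (hmd : m ≤ d)
    (hfix : ∀ v ∈ freeBall d 1, (∀ j : Fin d, m ≤ (j : ℕ) → v j = 0) → f.app 1 v = v)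
    {X : MatTuple d n} (hX : X ∈ freeBall d n) (hX0 : ∀ j : Fin d, m ≤ (j : ℕ) → X j = 0) :
    f.app n X = X := by
  have h0 : f.app 1 0 = 0 := hfix 0 (zero_mem_freeBall d 1) fun _ _ => rfl
  obtain ⟨D, hD⟩ := exists_eq_conjTranspose_mul_self (Matrix.PosDef.posSemidef hX)
  set i₀ : Fin d := ⟨0, by omega⟩ with hi₀
  set i₁ : Fin d := ⟨1, by omega⟩ with hi₁
  have hne : i₀ ≠ i₁ := by simp [hi₀, hi₁]
  set P : MatTuple d n := Pi.single i₀ Dᴴ with hP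
  set W : MatTuple d n := Pi.single i₁ 1 with hW
  have hXP : ∑ j, (X j * (X j)ᴴ + P j * (P j)ᴴ) = 1 := by
    have : ∑ j, P j * (P j)ᴴ = Dᴴ * D := by
      rw [Finset.sum_eq_single i₀] <;> simp +contextual [hP]
    rw [Finset.sum_add_distrib, this, ← hD, add_sub_cancel]
  have hPW : ∑ j, P j * (W j)ᴴ = 0 := by
    refine Finset.sum_eq_zero fun j _ => ?_
    rcases eq_or_ne j i₀ with rfl | hj
    · simp [hW, hne]
    · simp [hP, hj]
  have hWW : ∑ j, W j * (W j)ᴴ = 1 := by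
    rw [Finset.sum_eq_single i₁] <;> simp +contextual [hW]
  have hfd : fderiv ℂ (f.app (n + n)) 0 (upperBlock X P W) = upperBlock X P W := by
    refine f.fderiv_app_eq_self hfix fun j hj => ?_
    have hj₀ : j ≠ i₀ := by
      rintro rfl
      simp [hi₀] at hj
      omega
    have hj₁ : j ≠ i₁ := by
      rintro rfl
      simp [hi₁] at hj
      omega
    simp [upperBlock, hP, hW, hj₀, hj₁, hX0 j hj]
  have hWb : ∀ b, ‖rowOp d n W b‖ = ‖b‖ := norm_rowOp_of_coisometry hWW
  have hscaled : ∀ t : ℂ, ‖t‖ < 1 → f.app n (t • X) = t • X := fun t ht => by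
    have hlim : Filter.Tendsto (fun r : ℝ => t • upperBlock X ((r : ℂ) • P) W)
        (nhdsWithin 0 (Set.Ioi 0)) (nhds (t • upperBlock X 0 W)) := by
      have hc : Continuous fun r : ℝ => upperBlock X ((r : ℂ) • P) W := by
        refine continuous_pi fun j => ?_
        have hP : Continuous fun r : ℝ => ((r : ℂ) • P) j := by
          simp only [Pi.smul_apply]
          fun_prop
        exact (Continuous.matrix_fromBlocks continuous_const hP continuous_const
          continuous_const).matrix_submatrix _ _
      have hct : Continuous fun r : ℝ => t • upperBlock X ((r : ℂ) • P) W := hc.const_smul t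
      have := (hct.tendsto 0).mono_left (nhdsWithin_le_nhds (s := Set.Ioi 0))
      simpa using this
    have hmem : t • upperBlock X 0 W ∈ freeBall d (n + n) := by
      have := norm_rowOp_upperBlock_le hXP hPW hWW le_rfl zero_le_one
      simp only [Complex.ofReal_zero, zero_smul] at this
      exact smul_mem_freeBall_of_norm_rowOp this ht
    have heq : f.app (n + n) (t • upperBlock X 0 W) = t • upperBlock X 0 W := by
      refine tendsto_nhds_unique
        ((f.differentiableAt_app hmem).continuousAt.tendsto.comp hlim) (hlim.congr' ?_)
      filter_upwards [Ioo_mem_nhdsGT (zero_lt_one' ℝ)] with r hr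
      exact (f.app_smul_upperBlock h0 hXP hPW hWW hfd ht hr.1 hr.2.le).symm
    have hsum : t • upperBlock X 0 W = dSum (t • X) (t • W) := by
      rw [upperBlock_zero]
      ext j p q
      simp only [dSum, reindex_apply, submatrix_apply, Pi.smul_apply, Matrix.smul_apply]
      rcases finSumFinEquiv.symm p with p | p <;> rcases finSumFinEquiv.symm q with q | q <;>
      simp
    rw [hsum, f.map_dSum _ _ (smul_mem_freeBall_s14 hX ht.le)
      (smul_mem_freeBall_of_norm_rowOp (fun b => (hWb b).le) ht)] at heq
    ext j p q
    have := congrFun (congrFun (congrFun heq j) (Fin.castAdd n p)) (Fin.castAdd n q)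
    simpa [dSum] using this
  have hlim : Filter.Tendsto (fun r : ℝ => (r : ℂ) • X) (nhdsWithin 1 (Set.Iio 1)) (nhds X) := by
    have hc : Continuous fun r : ℝ => (r : ℂ) • X := by fun_prop
    simpa using (hc.tendsto 1).mono_left (nhdsWithin_le_nhds (s := Set.Iio 1))
  refine tendsto_nhds_unique ((f.differentiableAt_app hX).continuousAt.tendsto.comp hlim)
    (hlim.congr' ?_)
  filter_upwards [Ioo_mem_nhdsLT (zero_lt_one' ℝ)] with r hr
  exact (hscaled r (by simpa [abs_of_pos hr.1] using hr.2)).symm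

end NCSelfMap

/-- The entrywise coordinates of a tuple of matrices with index at least `m`. -/
noncomputable def tailCoord (d n m : ℕ) :
    MatTuple d n →L[ℂ] (Fin n → Fin n → EuclideanSpace ℂ (Fin d)) :=
  LinearMap.toContinuousLinearMap
    { toFun := fun X p q => WithLp.toLp 2 fun j => if m ≤ (j : ℕ) then X j p q else 0
      map_add' := fun X Y => by
        ext p q j
        by_cases h : m ≤ (j : ℕ) <;> simp [h]
      map_smul' := fun c X => by
        ext p q j
        by_cases h : m ≤ (j : ℕ) <;> simp [h] }

theorem tailCoord_apply {d n m : ℕ} (X : MatTuple d n) (p q : Fin n) (j : Fin d) :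
    tailCoord d n m X p q j = if m ≤ (j : ℕ) then X j p q else 0 := rfl

theorem tailCoord_eq_zero_iff {d n m : ℕ} {X : MatTuple d n} :
    tailCoord d n m X = 0 ↔ ∀ j : Fin d, m ≤ (j : ℕ) → X j = 0 := by
  refine ⟨fun h j hj => ?_, fun h => ?_⟩
  · ext p q
    have := congrArg (fun w => w p q j) h
    simpa [tailCoord_apply, hj] using this
  · ext p q j
    rw [tailCoord_apply]
    split_ifs with hj
    · simp [h j hj]
    · simp

/-- The tuple of matrices with given entrywise coordinates. -/
noncomputable def ofCoord (d n : ℕ) :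
    (Fin n → Fin n → EuclideanSpace ℂ (Fin d)) →L[ℂ] MatTuple d n :=
  LinearMap.toContinuousLinearMap
    { toFun := fun w j => Matrix.of fun p q => w p q j
      map_add' := fun _ _ => rfl
      map_smul' := fun _ _ => rfl }

theorem tailCoord_ofCoord {d n m : ℕ} (X : MatTuple d n) :
    tailCoord d n m (ofCoord d n (tailCoord d n m X)) = tailCoord d n m X := by
  ext p q j
  rw [tailCoord_apply, tailCoord_apply]
  split_ifs with hj
  · change tailCoord d n m X p q j = _
    rw [tailCoord_apply, if_pos hj]
  · rfl

namespace NCSelfMap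

variable {d : ℕ} (f : NCSelfMap d)

theorem norm_tailCoord_le {m n : ℕ}
    (hfix : ∀ v ∈ freeBall d 1, (∀ j : Fin d, m ≤ (j : ℕ) → v j = 0) → f.app 1 v = v)
    {c : ℝ} (hc0 : 0 ≤ c)
    (hc : ∀ v : Fin d → ℂ, (∀ j : Fin d, (j : ℕ) < m → v j = 0) →
      ‖(WithLp.toLp 2 ((2⁻¹ : ℂ) • (v + f.jacobian *ᵥ v)) : EuclideanSpace ℂ (Fin d))‖ ≤
        c * ‖(WithLp.toLp 2 v : EuclideanSpace ℂ (Fin d))‖) (X : MatTuple d n) :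
    ‖tailCoord d n m ((2⁻¹ : ℂ) • (X + fderiv ℂ (f.app n) 0 X))‖ ≤ c * ‖tailCoord d n m X‖ := by
  have hnn : 0 ≤ c * ‖tailCoord d n m X‖ := by positivity
  refine (pi_norm_le_iff_of_nonneg hnn).2 fun p => (pi_norm_le_iff_of_nonneg hnn).2 fun q => ?_
  have h := hc (tailCoord d n m X p q).ofLp fun j hj => by
    rw [tailCoord_apply, if_neg (by omega)]
  refine le_trans ?_ (h.trans (mul_le_mul_of_nonneg_left
    ((norm_le_pi_norm (tailCoord d n m X p) q).trans
      (norm_le_pi_norm (tailCoord d n m X) p)) hc0))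
  rw [EuclideanSpace.norm_eq, EuclideanSpace.norm_eq]
  refine Real.sqrt_le_sqrt (Finset.sum_le_sum fun j _ => ?_)
  rw [tailCoord_apply]
  split_ifs with hj
  · refine le_of_eq (congrArg (fun z : ℂ => ‖z‖ ^ 2) ?_)
    have hsum : fderiv ℂ (f.app n) 0 X j p q =
        (f.jacobian *ᵥ (tailCoord d n m X p q).ofLp) j := by
      rw [fderiv_app, Matrix.sum_apply, mulVec, dotProduct]
      refine Finset.sum_congr rfl fun k _ => ?_
      rw [tailCoord_apply, Matrix.smul_apply, smul_eq_mul]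
      split_ifs with hk
      · rfl
      · rw [f.jacobian_apply_of_fixed hfix j (by omega), Matrix.one_apply_ne, zero_mul, mul_zero]
        rintro rfl
        exact hk hj
    simp only [Pi.smul_apply, Pi.add_apply, Matrix.smul_apply, Matrix.add_apply, hsum,
      tailCoord_apply, if_pos hj]
  · rw [norm_zero, zero_pow two_ne_zero]
    exact sq_nonneg _

end NCSelfMap

/-- if the level-1 fixed point set of an nc self-map is exactly the points
supported on the first `m` coordinates (`2 ≤ m ≤ d`), then so is the fixed point set on
every level. -/
theorem stmt_14 {d m : ℕ} (f : NCSelfMap d) (hm2 : 2 ≤ m) (hmd : m ≤ d)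
    (hfix1 : ∀ v ∈ freeBall d 1, (f.app 1 v = v ↔ ∀ j : Fin d, m ≤ (j : ℕ) → v j = 0)) :
    ∀ n : ℕ, 1 ≤ n → ∀ X ∈ freeBall d n,
      (f.app n X = X ↔ ∀ j : Fin d, m ≤ (j : ℕ) → X j = 0) := by
  intro n _ X hX
  have hfix : ∀ v ∈ freeBall d 1, (∀ j : Fin d, m ≤ (j : ℕ) → v j = 0) → f.app 1 v = v :=
    fun v hv => (hfix1 v hv).2
  refine ⟨fun hfX => ?_, f.app_eq_self_of_fixed hm2 hmd hfix hX⟩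
  have h0 : f.app 1 0 = 0 := hfix 0 (zero_mem_freeBall d 1) fun _ _ => rfl
  obtain ⟨C, hC⟩ := exists_norm_le_rowOp d n
  obtain ⟨c, hc0, hc1, hc⟩ := f.exists_contraction hfix1
  rw [← tailCoord_eq_zero_iff]
  have hd := f.holo n
  have hmaps := f.mapsTo n
  rw [freeBall_eq] at hd hmaps
  refine eq_zero_of_fixed_of_contraction (rowOp d n) hC hd hmaps (f.app_zero_s14 h0 n) (tailCoord d n m) (ofCoord d n)
    tailCoord_ofCoord (fun Z hZ hQ => ?_) hc0 hc1 (f.norm_tailCoord_le hfix hc0 hc)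
    (mem_freeBall_iff.1 hX) hfX
  exact f.app_eq_self_of_fixed hm2 hmd hfix (mem_freeBall_iff.2 hZ) (tailCoord_eq_zero_iff.1 hQ)
end
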